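/- Let Ω ⊆ ℝⁿ, n ≥ 3, be open and bounded. Then for every u ∈ W^{2,1}_{Δ,0}(Ω) one has ‖u‖*_{n/(n−2),∞} ≤ 2^{−2/n} c_n (ω_{n-1}/n)^{(n−2)/n} ‖Δu‖_{L¹(Ω)}, and the constant 2^{−2/n} c_n (ω_{n-1}/n)^{(n−2)/n} is sharp: it cannot be replaced by any smaller constant. -/

import Mathlib

open MeasureTheory Filter Topology
open scoped ENNReal

noncomputable section

/-- Euclidean space ℝⁿ. -/
abbrev Euc (n : ℕ) := EuclideanSpace ℝ (Fin n)

/-- The (pointwise) Laplacian of a function on ℝⁿ: the trace of the second derivative. -/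
def lapl (n : ℕ) (φ : Euc n → ℝ) (x : Euc n) : ℝ :=
  ∑ i : Fin n,
    iteratedFDeriv ℝ 2 φ x ![EuclideanSpace.single i (1 : ℝ), EuclideanSpace.single i (1 : ℝ)]

/-- A test function on Ω: smooth and compactly supported inside Ω. -/
def IsTestFun (n : ℕ) (Ω : Set (Euc n)) (φ : Euc n → ℝ) : Prop :=
  ContDiff ℝ (⊤ : ℕ∞) φ ∧ HasCompactSupport φ ∧ tsupport φ ⊆ Ω

/-- `u ∈ W₀^{1,1}(Ω)`: `u` is an L¹(Ω) limit of test functions whose gradients converge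
in L¹(Ω) (i.e. `u` is in the closure of C_c^∞(Ω) in the W^{1,1} norm). -/
def MemW0_1_1 (n : ℕ) (Ω : Set (Euc n)) (u : Euc n → ℝ) : Prop :=
  IntegrableOn u Ω volume ∧
  ∃ φ : ℕ → Euc n → ℝ, (∀ k, IsTestFun n Ω (φ k)) ∧
    Tendsto (fun k => ∫ x in Ω, |φ k x - u x|) atTop (𝓝 0) ∧
    ∃ g : Euc n → Euc n →L[ℝ] ℝ,
      IntegrableOn (fun x => ‖g x‖) Ω volume ∧
      Tendsto (fun k => ∫ x in Ω, ‖fderiv ℝ (φ k) x - g x‖) atTop (𝓝 0)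

/-- `u ∈ W^{2,1}_Δ(Ω)` with distributional Laplacian `f ∈ L¹(Ω)`. -/
def MemW21Delta (n : ℕ) (Ω : Set (Euc n)) (u f : Euc n → ℝ) : Prop :=
  MemW0_1_1 n Ω u ∧ IntegrableOn f Ω volume ∧
    ∀ ψ : Euc n → ℝ, IsTestFun n Ω ψ →
      ∫ x in Ω, u x * lapl n ψ x = ∫ x in Ω, f x * ψ x

/-- `u ∈ W^{2,1}_{Δ,0}(Ω)` with Laplacian `f`: `u` is an L¹(Ω) limit of test functions `φ k`
with `Δ(φ k) → f` in L¹(Ω) (closure of C_c^∞(Ω) in the norm ‖Δu‖₁). -/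
def MemW21Delta0 (n : ℕ) (Ω : Set (Euc n)) (u f : Euc n → ℝ) : Prop :=
  IntegrableOn u Ω volume ∧ IntegrableOn f Ω volume ∧
  ∃ φ : ℕ → Euc n → ℝ, (∀ k, IsTestFun n Ω (φ k)) ∧
    Tendsto (fun k => ∫ x in Ω, |φ k x - u x|) atTop (𝓝 0) ∧
    Tendsto (fun k => ∫ x in Ω, |lapl n (φ k) x - f x|) atTop (𝓝 0)

/-- The decreasing rearrangement `u*(t)` of `u` on Ω. -/
def decRearr (n : ℕ) (Ω : Set (Euc n)) (u : Euc n → ℝ) (t : ℝ) : ℝ :=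
  sInf {s : ℝ | 0 ≤ s ∧ volume {x ∈ Ω | s < |u x|} ≤ ENNReal.ofReal t}

/-- `‖f‖_{L¹(Ω)}`. -/
def L1norm (n : ℕ) (Ω : Set (Euc n)) (f : Euc n → ℝ) : ℝ := ∫ x in Ω, |f x|

/-- ω_{n-1}: surface measure of the unit sphere in ℝⁿ. -/
def omegaS (n : ℕ) : ℝ := 2 * Real.pi ^ ((n : ℝ) / 2) / Real.Gamma ((n : ℝ) / 2)

/-- c_n = 1/((n-2) ω_{n-1}). -/
def cConst (n : ℕ) : ℝ := 1 / (((n : ℝ) - 2) * omegaS n)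

/-- `N*_V(t)`: the rearrangement of the Green function of the ball of volume V. -/
def NstarV (n : ℕ) (V t : ℝ) : ℝ :=
  if n = 2 then (1 / (4 * Real.pi)) * Real.log (V / t)
  else cConst n * (omegaS n / (n : ℝ)) ^ (((n : ℝ) - 2) / (n : ℝ)) *
    (t ^ (-(((n : ℝ) - 2) / (n : ℝ))) - V ^ (-(((n : ℝ) - 2) / (n : ℝ))))

/-- `N*_∞(t)` (for n ≥ 3). -/
def NstarInf (n : ℕ) (t : ℝ) : ℝ :=
  cConst n * (omegaS n / (n : ℝ)) ^ (((n : ℝ) - 2) / (n : ℝ)) *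
    t ^ (-(((n : ℝ) - 2) / (n : ℝ)))

/-- The maximal function `u**(t) = (1/t) ∫₀ᵗ u*(s) ds`. -/
def maximalFn (n : ℕ) (Ω : Set (Euc n)) (u : Euc n → ℝ) (t : ℝ) : ℝ :=
  (1 / t) * ∫ s in (0:ℝ)..t, decRearr n Ω u s

/-- `u ∈ L_exp(Ω)`. -/
def MemLexp (n : ℕ) (Ω : Set (Euc n)) (u : Euc n → ℝ) : Prop :=
  ∃ M : ℝ, ∀ t : ℝ, 0 < t → t ≤ (volume Ω).toReal →
    decRearr n Ω u t / (1 + Real.log ((volume Ω).toReal / t)) ≤ M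

/-- `u ∈ L_{exp,0}(Ω)`. -/
def MemLexp0 (n : ℕ) (Ω : Set (Euc n)) (u : Euc n → ℝ) : Prop :=
  MemLexp n Ω u ∧
    Tendsto (fun t : ℝ => maximalFn n Ω u t / Real.log (1 / t)) (𝓝[>] 0) (𝓝 0)

/-- `u ∈ L^{n/(n-2),∞}(Ω)`. -/
def MemWeakL (n : ℕ) (Ω : Set (Euc n)) (u : Euc n → ℝ) : Prop :=
  ∃ M : ℝ, ∀ t : ℝ, 0 < t → t ≤ (volume Ω).toReal →
    t ^ (((n : ℝ) - 2) / (n : ℝ)) * decRearr n Ω u t ≤ M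

/-- `u ∈ L₀^{n/(n-2),∞}(Ω)`. -/
def MemWeakL0 (n : ℕ) (Ω : Set (Euc n)) (u : Euc n → ℝ) : Prop :=
  MemWeakL n Ω u ∧
    Tendsto (fun t : ℝ => t ^ (((n : ℝ) - 2) / (n : ℝ)) * maximalFn n Ω u t) (𝓝[>] 0) (𝓝 0)

/-- `Λ_n^0(Ω)`: equals `L_{exp,0}(Ω)` if n = 2 and `L₀^{n/(n-2),∞}(Ω)` if n ≥ 3. -/
def MemLambda0 (n : ℕ) (Ω : Set (Euc n)) (u : Euc n → ℝ) : Prop :=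
  if n = 2 then MemLexp0 n Ω u else MemWeakL0 n Ω u

/-- The weak-L^{n/(n-2)} quasi-norm on Ω ⊆ ℝⁿ. -/
def WeakNorm (n : ℕ) (Omg : Set (Euc n)) (u : Euc n → ℝ) : ℝ :=
  sSup {r : ℝ | ∃ t : ℝ, 0 < t ∧ t ≤ (volume Omg).toReal ∧
    r = t ^ (((n : ℝ) - 2) / (n : ℝ)) * decRearr n Omg u t}

/-! ### The Brunn–Minkowski inequality for bounded open sets -/

open scoped Pointwise in
theorem IsCompact.volume_add_volume_le {K L : Set ℝ} (hK : IsCompact K) (hL : IsCompact L)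
    (hK0 : K.Nonempty) (hL0 : L.Nonempty) : volume K + volume L ≤ volume (K + L) := by
  set k := sSup K
  set l := sInf L
  have hk : k ∈ K := hK.sSup_mem hK0
  have hl : l ∈ L := hL.sInf_mem hL0
  have hS : volume ((fun x => x + l) '' K) = volume K := by
    rw [Set.image_add_right, measure_preimage_add_right]
  have hT : volume ((fun y => k + y) '' L) = volume L := by
    rw [Set.image_add_left, measure_preimage_add]
  have hTm : MeasurableSet ((fun y => k + y) '' L) :=
    (hL.image (by fun_prop)).measurableSet
  have hd : AEDisjoint volume ((fun x => x + l) '' K) ((fun y => k + y) '' L) := by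
    refine measure_mono_null (t := {k + l}) ?_ (by simp)
    rintro _ ⟨⟨x, hx, rfl⟩, ⟨y, hy, hxy⟩⟩
    have h1 : x ≤ k := le_csSup hK.bddAbove hx
    have h2 : l ≤ y := csInf_le hL.bddBelow hy
    simp only at hxy
    simp only [Set.mem_singleton_iff]
    linarith
  rw [← hS, ← hT, ← measure_union₀ hTm.nullMeasurableSet hd]
  refine measure_mono (Set.union_subset ?_ ?_)
  · rintro _ ⟨x, hx, rfl⟩
    exact Set.add_mem_add hx hl
  · rintro _ ⟨x, hx, rfl⟩
    exact Set.add_mem_add hk hx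

open scoped Pointwise in
theorem MeasurableSet.volume_add_volume_le {A B : Set ℝ} (hA : MeasurableSet A)
    (hB : MeasurableSet B) (hA0 : A.Nonempty) (hB0 : B.Nonempty) :
    volume A + volume B ≤ volume (A + B) := by
  obtain ⟨a, ha⟩ := hA0
  obtain ⟨b, hb⟩ := hB0
  rw [hA.measure_eq_iSup_isCompact, hB.measure_eq_iSup_isCompact]
  simp only [iSup_and']
  refine ENNReal.biSup_add_biSup_le' ⟨∅, by simp⟩ ⟨∅, by simp⟩ ?_
  rintro K ⟨hKA, hK⟩ L ⟨hLB, hL⟩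
  calc volume K + volume L ≤ volume (insert a K) + volume (insert b L) := by
        gcongr <;> exact Set.subset_insert _ _
    _ ≤ volume (insert a K + insert b L) :=
        (hK.insert a).volume_add_volume_le (hL.insert b) (Set.insert_nonempty _ _)
          (Set.insert_nonempty _ _)
    _ ≤ volume (A + B) := measure_mono
        (Set.add_subset_add (Set.insert_subset ha hKA) (Set.insert_subset hb hLB))

/-- A one-dimensional functional form of the Brunn–Minkowski inequality. -/
theorem lintegral_add_lintegral_le_of_superlevel {f g h : ℝ → ℝ} (hf : Measurable f)
    (hg : Measurable g) (hh : Measurable h) (hf0 : ∀ x, 0 ≤ f x) (hg0 : ∀ x, 0 ≤ g x)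
    (hh0 : ∀ x, 0 ≤ h x) (hf1 : ∀ x, f x ≤ 1) (hg1 : ∀ x, g x ≤ 1)
    (hfs : ∀ t < 1, ∃ x, t ≤ f x) (hgs : ∀ t < 1, ∃ x, t ≤ g x)
    (H : ∀ t, 0 < t → t < 1 → ∀ x y, t ≤ f x → t ≤ g y → t ≤ h (x + y)) :
    (∫⁻ x, ENNReal.ofReal (f x)) + (∫⁻ x, ENNReal.ofReal (g x)) ≤ ∫⁻ x, ENNReal.ofReal (h x) := by
  rw [lintegral_eq_lintegral_meas_le _ (Eventually.of_forall hf0) hf.aemeasurable,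
    lintegral_eq_lintegral_meas_le _ (Eventually.of_forall hg0) hg.aemeasurable,
    lintegral_eq_lintegral_meas_le _ (Eventually.of_forall hh0) hh.aemeasurable,
    ← lintegral_add_left]
  · refine lintegral_mono_ae ?_
    have h1 : ∀ᵐ t : ℝ ∂volume.restrict (Set.Ioi 0), t ≠ 1 :=
      ae_restrict_of_ae (by simp [ae_iff, measure_singleton])
    filter_upwards [h1, ae_restrict_mem measurableSet_Ioi] with t ht1 ht0
    rcases lt_or_gt_of_ne ht1 with ht | ht
    · refine (MeasurableSet.volume_add_volume_le (measurableSet_le measurable_const hf)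
        (measurableSet_le measurable_const hg) (hfs t ht) (hgs t ht)).trans (measure_mono ?_)
      rintro _ ⟨x, hx, y, hy, rfl⟩
      exact H t ht0 ht x y hx hy
    · have e1 : {a | t ≤ f a} = ∅ := by
        ext a; simpa using (hf1 a).trans_lt ht
      have e2 : {a | t ≤ g a} = ∅ := by
        ext a; simpa using (hg1 a).trans_lt ht
      simp [e1, e2]
  · exact Antitone.measurable (fun s t hst => measure_mono fun a ha => hst.trans ha)

theorem add_pow_succ_le_radon {P Q p q : ℝ} (hP : 0 ≤ P) (hQ : 0 ≤ Q) (hp : 0 < p) (hq : 0 < q)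
    (n : ℕ) : (P + Q) ^ (n + 1) ≤ (p + q) ^ n * (P ^ (n + 1) / p ^ n + Q ^ (n + 1) / q ^ n) := by
  have hPp : P / p ∈ Set.Ici (0 : ℝ) := Set.mem_Ici.2 (by positivity)
  have hQq : Q / q ∈ Set.Ici (0 : ℝ) := Set.mem_Ici.2 (by positivity)
  have ha : 0 ≤ p / (p + q) := by positivity
  have hb : 0 ≤ q / (p + q) := by positivity
  have hab : p / (p + q) + q / (p + q) = 1 := by field_simp
  have h := (convexOn_pow (𝕜 := ℝ) (n + 1)).2 hPp hQq ha hb hab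
  simp only [smul_eq_mul] at h
  have e1 : p / (p + q) * (P / p) + q / (p + q) * (Q / q) = (P + Q) / (p + q) := by
    field_simp
  rw [e1, div_pow, div_le_iff₀ (by positivity)] at h
  refine h.trans (le_of_eq ?_)
  rw [div_pow, div_pow]
  field_simp
  ring

theorem preimage_piFinSuccAbove_symm {n : ℕ} (A : Set (Fin (n + 1) → ℝ)) (x : ℝ) :
    Prod.mk x ⁻¹' ((MeasurableEquiv.piFinSuccAbove (fun _ : Fin (n + 1) => ℝ) 0).symm ⁻¹' A) =
      {y : Fin n → ℝ | (Fin.cons x y : Fin (n + 1) → ℝ) ∈ A} := by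
  ext y
  simp [MeasurableEquiv.piFinSuccAbove, Fin.consEquiv]

theorem volume_eq_lintegral_volume_cons {n : ℕ} {A : Set (Fin (n + 1) → ℝ)}
    (hA : MeasurableSet A) :
    volume A = ∫⁻ x : ℝ, volume {y : Fin n → ℝ | (Fin.cons x y : Fin (n + 1) → ℝ) ∈ A} := by
  have h := (volume_preserving_piFinSuccAbove (fun _ : Fin (n + 1) => ℝ) 0).symm
  rw [← h.measure_preimage hA.nullMeasurableSet, Measure.volume_eq_prod,
    Measure.prod_apply (hA.preimage (MeasurableEquiv.measurable _))]
  simp_rw [preimage_piFinSuccAbove_symm]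

theorem measurable_volume_cons {n : ℕ} {A : Set (Fin (n + 1) → ℝ)} (hA : MeasurableSet A) :
    Measurable fun x : ℝ => volume {y : Fin n → ℝ | (Fin.cons x y : Fin (n + 1) → ℝ) ∈ A} := by
  simp_rw [← preimage_piFinSuccAbove_symm]
  exact measurable_measure_prodMk_left
    (hA.preimage (MeasurableEquiv.piFinSuccAbove (fun _ : Fin (n + 1) => ℝ) 0).symm.measurable)

theorem isOpen_cons_preimage {n : ℕ} {A : Set (Fin (n + 1) → ℝ)} (hA : IsOpen A) (x : ℝ) :
    IsOpen {y : Fin n → ℝ | (Fin.cons x y : Fin (n + 1) → ℝ) ∈ A} :=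
  hA.preimage (f := fun y : Fin n → ℝ => (Fin.cons x y : Fin (n + 1) → ℝ)) (by fun_prop)

theorem exists_forall_cons_preimage_subset {n : ℕ} {A : Set (Fin (n + 1) → ℝ)}
    (hA : Bornology.IsBounded A) : ∃ R : ℝ, ∀ x : ℝ,
      {y : Fin n → ℝ | (Fin.cons x y : Fin (n + 1) → ℝ) ∈ A} ⊆ Metric.closedBall 0 R := by
  obtain ⟨R, hR⟩ := hA.subset_closedBall 0
  refine ⟨R, fun x y hy => ?_⟩
  have h := hR hy
  rw [mem_closedBall_zero_iff] at h ⊢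
  have hR0 : 0 ≤ R := (norm_nonneg _).trans h
  rw [pi_norm_le_iff_of_nonneg hR0] at h ⊢
  intro i
  simpa using h i.succ

open scoped Pointwise in
theorem brunn_minkowski_pi_one {A B : Set (Fin 1 → ℝ)} (hAo : IsOpen A) (hBo : IsOpen B)
    (hA : A.Nonempty) (hB : B.Nonempty) {P Q : ℝ} (hP : 0 ≤ P) (hQ : 0 ≤ Q)
    (hPA : ENNReal.ofReal (P ^ 1) ≤ volume A) (hQB : ENNReal.ofReal (Q ^ 1) ≤ volume B) :
    ENNReal.ofReal ((P + Q) ^ 1) ≤ volume (A + B) := by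
  have key : ∀ S : Set (Fin 1 → ℝ),
      volume {r : ℝ | (fun _ : Fin 1 => r) ∈ S} = volume S := fun S =>
    (volume_preserving_funUnique (Fin 1) ℝ).symm.measure_preimage_equiv S
  have ho : ∀ S : Set (Fin 1 → ℝ), IsOpen S →
      MeasurableSet {r : ℝ | (fun _ : Fin 1 => r) ∈ S} := fun S hS =>
    (hS.preimage (f := fun r : ℝ => fun _ : Fin 1 => r) (by fun_prop)).measurableSet
  have hne : ∀ S : Set (Fin 1 → ℝ), S.Nonempty →
      {r : ℝ | (fun _ : Fin 1 => r) ∈ S}.Nonempty := by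
    rintro S ⟨x, hx⟩
    refine ⟨x 0, ?_⟩
    have : (fun _ => x 0) = x := by ext i; rw [Subsingleton.elim i 0]
    simpa [this] using hx
  rw [pow_one, ENNReal.ofReal_add hP hQ]
  rw [pow_one] at hPA hQB
  refine (add_le_add hPA hQB).trans ?_
  rw [← key A, ← key B, ← key (A + B)]
  refine (MeasurableSet.volume_add_volume_le (ho A hAo) (ho B hBo) (hne A hA)
    (hne B hB)).trans (measure_mono ?_)
  rintro _ ⟨x, hx, y, hy, rfl⟩
  exact ⟨_, hx, _, hy, rfl⟩

open scoped Pointwise in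
/-- The Brunn–Minkowski inequality for nonempty bounded open sets, stated without roots. -/
theorem brunn_minkowski_pi (n : ℕ) : ∀ A B : Set (Fin n → ℝ), IsOpen A → IsOpen B →
    A.Nonempty → B.Nonempty → Bornology.IsBounded A → Bornology.IsBounded B →
    ∀ P Q : ℝ, 0 ≤ P → 0 ≤ Q → ENNReal.ofReal (P ^ n) ≤ volume A →
      ENNReal.ofReal (Q ^ n) ≤ volume B → ENNReal.ofReal ((P + Q) ^ n) ≤ volume (A + B) := by
  induction n with
  | zero =>
    intro A B _ _ hA hB _ _ P Q _ _ hPA _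
    obtain ⟨b, hb⟩ := hB
    have : A ⊆ A + B := fun x hx => ⟨x, hx, b, hb, Subsingleton.elim _ _⟩
    simpa using hPA.trans (measure_mono this)
  | succ n ih =>
    rcases Nat.eq_zero_or_pos n with rfl | hn
    · intro A B hAo hBo hA hB _ _ P Q hP hQ hPA hQB
      exact brunn_minkowski_pi_one hAo hBo hA hB hP hQ hPA hQB
    intro A B hAo hBo hA hB hAb hBb P Q hP hQ hPA hQB
    have hn0 : n ≠ 0 := hn.ne'
    let s : Set (Fin (n + 1) → ℝ) → ℝ → Set (Fin n → ℝ) := fun S x =>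
      {y | (Fin.cons x y : Fin (n + 1) → ℝ) ∈ S}
    let v : Set (Fin (n + 1) → ℝ) → ℝ → ℝ := fun S x => (volume (s S x)).toReal
    have hfin : ∀ S, Bornology.IsBounded S → ∀ x, volume (s S x) ≠ ∞ := by
      intro S hS x
      obtain ⟨R, hR⟩ := exists_forall_cons_preimage_subset hS
      exact ((measure_mono (hR x)).trans_lt measure_closedBall_lt_top).ne
    have hbdd : ∀ S, Bornology.IsBounded S → BddAbove (Set.range (v S)) := by
      intro S hS
      obtain ⟨R, hR⟩ := exists_forall_cons_preimage_subset hS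
      refine ⟨(volume (Metric.closedBall (0 : Fin n → ℝ) R)).toReal, ?_⟩
      rintro _ ⟨x, rfl⟩
      exact ENNReal.toReal_mono measure_closedBall_lt_top.ne (measure_mono (hR x))
    have hpos : ∀ S, IsOpen S → S.Nonempty → Bornology.IsBounded S → 0 < ⨆ x, v S x := by
      rintro S hSo ⟨z, hz⟩ hS
      have h1 : (s S (z 0)).Nonempty := ⟨Fin.tail z, by simpa [s] using hz⟩
      exact (ENNReal.toReal_pos ((isOpen_cons_preimage hSo _).measure_pos volume h1).ne'
        (hfin S hS _)).trans_le (le_ciSup (hbdd S hS) (z 0))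
    have hmeas : ∀ S, IsOpen S → Measurable (v S) := fun S hS =>
      (measurable_volume_cons hS.measurableSet).ennreal_toReal
    have hint : ∀ S, IsOpen S → Bornology.IsBounded S → ∀ c, 0 < c →
        volume S = ENNReal.ofReal c * ∫⁻ x, ENNReal.ofReal (v S x / c) := by
      intro S hSo hS c hc
      rw [volume_eq_lintegral_volume_cons hSo.measurableSet,
        ← lintegral_const_mul _ ((hmeas S hSo).div_const c).ennreal_ofReal]
      refine lintegral_congr fun x => ?_
      rw [← ENNReal.ofReal_mul hc.le, mul_div_cancel₀ _ hc.ne']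
      exact (ENNReal.ofReal_toReal (hfin S hS x)).symm
    have hroot : ∀ x : ℝ, 0 ≤ x → (x ^ ((n : ℝ)⁻¹)) ^ n = x := fun x hx =>
      Real.rpow_inv_natCast_pow hx hn0
    set a := ⨆ x, v A x with ha_def
    set b := ⨆ x, v B x with hb_def
    have ha : 0 < a := hpos A hAo hA hAb
    have hb : 0 < b := hpos B hBo hB hBb
    set p := a ^ ((n : ℝ)⁻¹)
    set q := b ^ ((n : ℝ)⁻¹)
    have hp : 0 < p := Real.rpow_pos_of_pos ha _
    have hq : 0 < q := Real.rpow_pos_of_pos hb _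
    have hpa : p ^ n = a := hroot a ha.le
    have hqb : q ^ n = b := hroot b hb.le
    have hCo : IsOpen (A + B) := hAo.add_right
    have hCb : Bornology.IsBounded (A + B) := hAb.add hBb
    have hc : 0 < (p + q) ^ n := by positivity
    have hsub : ∀ x y, s A x + s B y ⊆ s (A + B) (x + y) := by
      rintro x y _ ⟨z, hz, w, hw, rfl⟩
      refine ⟨_, hz, _, hw, ?_⟩
      ext i
      refine Fin.cases ?_ (fun j => ?_) i <;> simp
    have hsup : ∀ S, Bornology.IsBounded S → 0 < (⨆ x, v S x) → ∀ t < 1,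
        ∃ x, t ≤ v S x / ⨆ x, v S x := by
      intro S hS h0 t ht
      obtain ⟨x, hx⟩ := exists_lt_of_lt_ciSup (f := v S) (b := t * ⨆ x, v S x) (by nlinarith)
      exact ⟨x, by rw [le_div_iff₀ h0]; exact hx.le⟩
    have hne : ∀ S x, 0 < v S x → (s S x).Nonempty := by
      intro S x h
      by_contra h'
      rw [Set.not_nonempty_iff_eq_empty] at h'
      simp [v, h'] at h
    have main := lintegral_add_lintegral_le_of_superlevel (f := fun x => v A x / a)
      (g := fun x => v B x / b) (h := fun x => v (A + B) x / (p + q) ^ n)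
      ((hmeas A hAo).div_const _) ((hmeas B hBo).div_const _) ((hmeas _ hCo).div_const _)
      (fun x => div_nonneg ENNReal.toReal_nonneg ha.le)
      (fun x => div_nonneg ENNReal.toReal_nonneg hb.le)
      (fun x => div_nonneg ENNReal.toReal_nonneg hc.le)
      (fun x => (div_le_one ha).2 (le_ciSup (hbdd A hAb) x))
      (fun x => (div_le_one hb).2 (le_ciSup (hbdd B hBb) x))
      (hsup A hAb ha) (hsup B hBb hb) (by
        intro t ht0 ht1 x y hx hy
        rw [le_div_iff₀ ha] at hx
        rw [le_div_iff₀ hb] at hy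
        rw [le_div_iff₀ hc]
        set σ := t ^ ((n : ℝ)⁻¹)
        have hσ : σ ^ n = t := hroot t ht0.le
        have hσ0 : 0 < σ := Real.rpow_pos_of_pos ht0 _
        have h := ih (s A x) (s B y) (isOpen_cons_preimage hAo x) (isOpen_cons_preimage hBo y)
          (hne A x (by nlinarith [mul_pos ht0 ha])) (hne B y (by nlinarith [mul_pos ht0 hb]))
          (by
            obtain ⟨R, hR⟩ := exists_forall_cons_preimage_subset hAb
            exact Metric.isBounded_closedBall.subset (hR x))
          (by
            obtain ⟨R, hR⟩ := exists_forall_cons_preimage_subset hBb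
            exact Metric.isBounded_closedBall.subset (hR y))
          (σ * p) (σ * q) (by positivity) (by positivity)
          (by
            rw [mul_pow, hσ, hpa]
            exact (ENNReal.ofReal_le_iff_le_toReal (hfin A hAb x)).2 hx)
          (by
            rw [mul_pow, hσ, hqb]
            exact (ENNReal.ofReal_le_iff_le_toReal (hfin B hBb y)).2 hy)
        have h2 := h.trans (measure_mono (hsub x y))
        rw [ENNReal.ofReal_le_iff_le_toReal (hfin _ hCb _), ← mul_add, mul_pow, hσ] at h2
        exact h2)
    rw [hint A hAo hAb a ha] at hPA
    rw [hint B hBo hBb b hb] at hQB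
    rw [hint _ hCo hCb _ hc]
    have hscale : ∀ (X c : ℝ) (I : ℝ≥0∞), 0 < c → ENNReal.ofReal X ≤ ENNReal.ofReal c * I →
        ENNReal.ofReal (X / c) ≤ I := by
      intro X c I hc h
      rw [ENNReal.ofReal_div_of_pos hc]
      exact ENNReal.div_le_of_le_mul' h
    calc ENNReal.ofReal ((P + Q) ^ (n + 1))
        ≤ ENNReal.ofReal ((p + q) ^ n * (P ^ (n + 1) / a + Q ^ (n + 1) / b)) := by
          rw [← hpa, ← hqb]
          exact ENNReal.ofReal_le_ofReal (add_pow_succ_le_radon hP hQ hp hq n)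
      _ = ENNReal.ofReal ((p + q) ^ n) *
            (ENNReal.ofReal (P ^ (n + 1) / a) + ENNReal.ofReal (Q ^ (n + 1) / b)) := by
          rw [ENNReal.ofReal_mul hc.le, ENNReal.ofReal_add (by positivity) (by positivity)]
      _ ≤ _ := by
          gcongr
          exact (add_le_add (hscale _ _ _ ha hPA) (hscale _ _ _ hb hQB)).trans main

open scoped Pointwise in
theorem brunn_minkowski {n : ℕ} {A B : Set (Euc n)} (hAo : IsOpen A) (hBo : IsOpen B)
    (hA : A.Nonempty) (hB : B.Nonempty) (hAb : Bornology.IsBounded A)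
    (hBb : Bornology.IsBounded B) {P Q : ℝ} (hP : 0 ≤ P) (hQ : 0 ≤ Q)
    (hPA : ENNReal.ofReal (P ^ n) ≤ volume A) (hQB : ENNReal.ofReal (Q ^ n) ≤ volume B) :
    ENNReal.ofReal ((P + Q) ^ n) ≤ volume (A + B) := by
  let e := EuclideanSpace.equiv (Fin n) ℝ
  have hv : ∀ S : Set (Euc n), volume (e.symm ⁻¹' S) = volume S := fun S =>
    (EuclideanSpace.volume_preserving_symm_measurableEquiv_toLp (Fin n)).symm.measure_preimage_equiv S
  have hb : ∀ S : Set (Euc n), Bornology.IsBounded S → Bornology.IsBounded (e.symm ⁻¹' S) := by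
    intro S hS
    have := e.lipschitz.isBounded_image hS
    rwa [e.image_eq_preimage_symm] at this
  have hne : ∀ S : Set (Euc n), S.Nonempty → (e.symm ⁻¹' S).Nonempty := fun S hS =>
    hS.preimage e.symm.surjective
  rw [← hv] at hPA hQB
  refine (brunn_minkowski_pi n _ _ (hAo.preimage e.symm.continuous)
    (hBo.preimage e.symm.continuous) (hne A hA) (hne B hB) (hb A hAb) (hb B hBb) P Q hP hQ hPA
    hQB).trans ?_
  rw [← hv (A + B)]
  refine measure_mono ?_
  rintro _ ⟨x, hx, y, hy, rfl⟩
  exact ⟨_, hx, _, hy, (map_add e.symm x y).symm⟩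

/-! ### A Sobolev-type inequality on level sets -/

theorem volume_ball_ge {n : ℕ} {q : ℝ}
    (hq : ENNReal.ofReal (q ^ n) ≤ volume (Metric.ball (0 : Euc n) 1)) {h : ℝ} (hh : 0 < h) :
    ENNReal.ofReal ((h * q) ^ n) ≤ volume (Metric.ball (0 : Euc n) h) := by
  rw [Measure.addHaar_ball_of_pos _ _ hh, finrank_euclideanSpace_fin, mul_pow,
    ENNReal.ofReal_mul (by positivity)]
  gcongr

open scoped Pointwise in
theorem volume_add_ball_ge {n : ℕ} (hn : n ≠ 0) {q : ℝ} (hq0 : 0 ≤ q)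
    (hq : ENNReal.ofReal (q ^ n) ≤ volume (Metric.ball (0 : Euc n) 1)) {h : ℝ} (hh : 0 < h)
    {A : Set (Euc n)} (hA : IsOpen A) (hAb : Bornology.IsBounded A) {P : ℝ} (hP : 0 < P)
    (hPA : ENNReal.ofReal (P ^ n) ≤ volume A) :
    volume A + ENNReal.ofReal (n * P ^ (n - 1) * (h * q)) ≤ volume (A + Metric.ball 0 h) := by
  have hne : A.Nonempty := by
    by_contra h'
    rw [Set.not_nonempty_iff_eq_empty] at h'
    rw [h', measure_empty, nonpos_iff_eq_zero, ENNReal.ofReal_eq_zero] at hPA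
    exact absurd hPA (not_le.2 (by positivity))
  have hfin : volume A ≠ ∞ := hAb.measure_lt_top.ne
  set R := (volume A).toReal ^ ((n : ℝ)⁻¹)
  have hR : R ^ n = (volume A).toReal := Real.rpow_inv_natCast_pow ENNReal.toReal_nonneg hn
  have hR0 : 0 ≤ R := Real.rpow_nonneg ENNReal.toReal_nonneg _
  have hRA : ENNReal.ofReal (R ^ n) = volume A := by rw [hR, ENNReal.ofReal_toReal hfin]
  have hPR : P ≤ R := by
    have := (ENNReal.ofReal_le_iff_le_toReal hfin).1 hPA
    rw [← hR] at this
    exact le_of_pow_le_pow_left₀ hn hR0 this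
  refine le_trans ?_ (brunn_minkowski hA Metric.isOpen_ball hne
    (Metric.nonempty_ball.2 hh) hAb Metric.isBounded_ball hR0 (by positivity) hRA.le
    (volume_ball_ge hq hh))
  rw [← hRA, ← ENNReal.ofReal_add (by positivity) (by positivity)]
  refine ENNReal.ofReal_le_ofReal ?_
  have hb := pow_add_mul_le_add_pow hR0 (by positivity : 0 ≤ 2 * R + h * q) n
  refine le_trans ?_ hb
  gcongr

open scoped Pointwise in
/-- If all superlevel sets of a nonnegative `C¹` function `w` at heights below `L` have volume at
least `P ^ n`, then `∫ ‖∇w‖` is at least `L` times the perimeter of a ball of volume `P ^ n`. -/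
theorem mul_le_integral_norm_fderiv {n : ℕ} (hn : n ≠ 0) {q : ℝ} (hq0 : 0 ≤ q)
    (hq : ENNReal.ofReal (q ^ n) ≤ volume (Metric.ball (0 : Euc n) 1)) {w : Euc n → ℝ}
    (hw : ContDiff ℝ 1 w) (hwc : HasCompactSupport w) (hw0 : ∀ x, 0 ≤ w x) {L P : ℝ} (hL : 0 ≤ L)
    (hP : 0 < P)
    (hPL : ∀ t, 0 < t → t < L → ENNReal.ofReal (P ^ n) ≤ volume {x | t < w x}) :
    n * P ^ (n - 1) * q * L ≤ ∫ x, ‖fderiv ℝ w x‖ := by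
  have hdc : Continuous (fderiv ℝ w) := hw.continuous_fderiv one_ne_zero
  have hdi : Integrable fun x => ‖fderiv ℝ w x‖ :=
    (hdc.integrable_of_hasCompactSupport (hwc.fderiv ℝ)).norm
  have hwi : Integrable w := hw.continuous.integrable_of_hasCompactSupport hwc
  have huc : UniformContinuous (fderiv ℝ w) := 
    hdc.uniformContinuous_of_tendsto_cocompact (hwc.fderiv ℝ).is_zero_at_infty
  set K := Metric.cthickening 1 (tsupport w)
  have hK : IsCompact K := hwc.isCompact.cthickening
  have hKm : MeasurableSet K := hK.measurableSet
  suffices H : ∀ ε > 0, n * P ^ (n - 1) * q * L ≤ (∫ x, ‖fderiv ℝ w x‖) + ε * volume.real K by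
    refine le_of_forall_pos_le_add fun η hη => ?_
    refine (H (η / (volume.real K + 1)) (by positivity)).trans ?_
    gcongr
    rw [div_mul_eq_mul_div, div_le_iff₀ (by positivity)]
    nlinarith [measureReal_nonneg (μ := volume) (s := K)]
  intro ε hε
  obtain ⟨δ, hδ, hδε⟩ := Metric.uniformContinuous_iff.1 huc ε hε
  set h := min (δ / 2) 1
  have hh : 0 < h := by positivity
  have hh1 : h ≤ 1 := min_le_right _ _
  have hhδ : h < δ := (min_le_left _ _).trans_lt (by linarith)
  set W : Euc n → ℝ := fun x => w x + h * (‖fderiv ℝ w x‖ + K.indicator (fun _ => ε) x)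
  have hKi : Integrable (K.indicator fun _ => ε) :=
    (integrable_indicator_iff hKm).2 (integrableOn_const hK.measure_lt_top.ne)
  have hWi : Integrable W := hwi.add ((hdi.add hKi).const_mul h)
  have hwW : ∀ x, w x ≤ W x := by
    intro x
    have : 0 ≤ K.indicator (fun _ => ε) x := Set.indicator_nonneg (fun _ _ => hε.le) x
    simp only [W]
    nlinarith [mul_nonneg hh.le (add_nonneg (norm_nonneg (fderiv ℝ w x)) this)]
  have hsub : ∀ t, 0 < t → {x | t < w x} + Metric.ball 0 h ⊆ {x | t < W x} := by
    rintro t ht _ ⟨x, hx, y, hy, rfl⟩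
    simp only [Set.mem_ofPred_eq] at hx ⊢
    rw [mem_ball_zero_iff] at hy
    have hxs : x ∈ tsupport w := subset_tsupport _ (by
      rw [Function.mem_support]; exact (ht.trans hx).ne')
    have hz : x + y ∈ K := by
      refine Metric.mem_cthickening_of_dist_le _ x _ _ hxs ?_
      rw [dist_eq_norm, add_sub_cancel_left]
      exact hy.le.trans hh1
    have hmv := Convex.norm_image_sub_le_of_norm_fderiv_le (𝕜 := ℝ) (f := w)
      (s := Metric.ball (x + y) δ) (C := ‖fderiv ℝ w (x + y)‖ + ε) (x := x + y) (y := x)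
      (fun z _ => (hw.differentiable one_ne_zero) z) (fun z hz => by
        have := hδε (a := z) (b := x + y) hz
        rw [dist_eq_norm] at this
        have h3 := norm_le_norm_add_norm_sub' (fderiv ℝ w z) (fderiv ℝ w (x + y))
        linarith) (convex_ball _ _) (Metric.mem_ball_self hδ) (by
          rw [Metric.mem_ball, dist_eq_norm, sub_add_cancel_left, norm_neg]
          exact hy.trans hhδ)
    rw [sub_add_cancel_left, norm_neg, Real.norm_eq_abs] at hmv
    simp only [W, Set.indicator_of_mem hz]
    have h4 := le_abs_self (w x - w (x + y))
    have h5 : (‖fderiv ℝ w (x + y)‖ + ε) * ‖y‖ ≤ h * (‖fderiv ℝ w (x + y)‖ + ε) := by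
      rw [mul_comm]; gcongr
    linarith
  have hW0 : ∀ x, 0 ≤ W x := fun x => (hw0 x).trans (hwW x)
  set c := n * P ^ (n - 1) * (h * q)
  have hc0 : 0 ≤ c := by positivity
  have hlc : ENNReal.ofReal (∫ x, w x) + ENNReal.ofReal (c * L) ≤ ENNReal.ofReal (∫ x, W x) := by
    rw [ofReal_integral_eq_lintegral_ofReal hwi (Eventually.of_forall hw0),
      ofReal_integral_eq_lintegral_ofReal hWi (Eventually.of_forall hW0),
      lintegral_eq_lintegral_meas_lt _ (Eventually.of_forall hw0) hwi.aemeasurable,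
      lintegral_eq_lintegral_meas_lt _ (Eventually.of_forall hW0) hWi.aemeasurable]
    have e : ENNReal.ofReal (c * L) =
        ∫⁻ t in Set.Ioi 0, (Set.Ioo 0 L).indicator (fun _ => ENNReal.ofReal c) t := by
      rw [lintegral_indicator measurableSet_Ioo, Measure.restrict_restrict measurableSet_Ioo,
        Set.inter_eq_left.2 Set.Ioo_subset_Ioi_self, setLIntegral_const, Real.volume_Ioo,
        ENNReal.ofReal_mul hc0, sub_zero]
    rw [e, ← lintegral_add_right _ (measurable_const.indicator measurableSet_Ioo)]
    refine setLIntegral_mono' measurableSet_Ioi fun t ht => ?_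
    by_cases htL : t < L
    · rw [Set.indicator_of_mem (Set.mem_Ioo.2 ⟨ht, htL⟩)]
      refine (volume_add_ball_ge hn hq0 hq hh (isOpen_lt continuous_const hw.continuous)
        ?_ hP (hPL t ht htL)).trans (measure_mono (hsub t ht))
      refine hwc.isCompact.isBounded.subset fun x hx => subset_tsupport _ ?_
      rw [Function.mem_support]
      exact ((Set.mem_Ioi.1 ht).trans hx).ne'
    · rw [Set.indicator_of_notMem (fun h' => htL h'.2), add_zero]
      exact measure_mono fun x hx => lt_of_lt_of_le hx (hwW x)
  rw [← ENNReal.ofReal_add (integral_nonneg hw0) (by positivity),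
    ENNReal.ofReal_le_ofReal_iff (integral_nonneg hW0)] at hlc
  have hWint : ∫ x, W x = (∫ x, w x) + h * ((∫ x, ‖fderiv ℝ w x‖) + ε * volume.real K) := by
    have h1 : Integrable fun x => h * (‖fderiv ℝ w x‖ + K.indicator (fun _ => ε) x) :=
      (hdi.add hKi).const_mul h
    rw [integral_add hwi h1, integral_const_mul, integral_add hdi hKi,
      integral_indicator_const _ hKm, smul_eq_mul, mul_comm ε]
  rw [hWint] at hlc
  have : h * (n * P ^ (n - 1) * q * L) ≤ h * ((∫ x, ‖fderiv ℝ w x‖) + ε * volume.real K) := by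
    have e : c * L = h * (n * P ^ (n - 1) * q * L) := by simp only [c]; ring
    linarith
  exact le_of_mul_le_mul_left this hh

/-! ### Energy identity for the Laplacian -/

theorem lapl_eq_sum_fderiv {n : ℕ} {u : Euc n → ℝ} (hu : ContDiff ℝ 2 u) (x : Euc n) :
    lapl n u x = ∑ i : Fin n, fderiv ℝ (fun y => fderiv ℝ u y (EuclideanSpace.single i 1)) x
      (EuclideanSpace.single i 1) := by
  refine Finset.sum_congr rfl fun i _ => ?_
  have hd : DifferentiableAt ℝ (fderiv ℝ u) x :=
    (hu.fderiv_right (m := 1) (by norm_num)).differentiable one_ne_zero x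
  rw [iteratedFDeriv_two_apply, fderiv_clm_apply hd (differentiableAt_const _)]
  simp

theorem sum_sq_apply_single {n : ℕ} (l : Euc n →L[ℝ] ℝ) :
    ∑ i : Fin n, l (EuclideanSpace.single i 1) ^ 2 = ‖l‖ ^ 2 := by
  obtain ⟨v, rfl⟩ := (InnerProductSpace.toDual ℝ (Euc n)).surjective l
  rw [LinearIsometryEquiv.norm_map, EuclideanSpace.norm_sq_eq]
  simp [InnerProductSpace.toDual_apply_apply, EuclideanSpace.inner_single_right]

theorem contDiff_fderiv_apply {n : ℕ} {u : Euc n → ℝ} (hu : ContDiff ℝ 2 u)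
    (v : Euc n) : ContDiff ℝ 1 fun y => fderiv ℝ u y v :=
  (hu.fderiv_right (m := 1) (by norm_num)).clm_apply contDiff_const

theorem continuous_lapl {n : ℕ} {u : Euc n → ℝ} (hu : ContDiff ℝ 2 u) :
    Continuous (lapl n u) := by
  rw [funext (lapl_eq_sum_fderiv hu)]
  exact continuous_finsetSum _ fun i _ =>
    ((contDiff_fderiv_apply hu _).continuous_fderiv one_ne_zero).clm_apply
      continuous_const

theorem tsupport_lapl_subset {n : ℕ} (u : Euc n → ℝ) : tsupport (lapl n u) ⊆ tsupport u := by
  refine closure_minimal (fun x hx => ?_) (isClosed_tsupport u)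
  by_contra h
  refine hx ?_
  have h0 : iteratedFDeriv ℝ 2 u x = 0 := by
    by_contra h1
    exact h (support_iteratedFDeriv_subset (𝕜 := ℝ) 2 h1)
  simp [lapl, h0]

theorem HasCompactSupport.lapl {n : ℕ} {u : Euc n → ℝ} (hc : HasCompactSupport u) :
    HasCompactSupport (lapl n u) :=
  hc.of_isClosed_subset (isClosed_tsupport _) (tsupport_lapl_subset u)

theorem integrable_lapl {n : ℕ} {u : Euc n → ℝ} (hu : ContDiff ℝ 2 u) (hc : HasCompactSupport u) :
    Integrable (lapl n u) :=
  (continuous_lapl hu).integrable_of_hasCompactSupport hc.lapl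

/-- Green's identity `∫ f Δu = -∫ ∇f · ∇u`. -/
theorem integral_mul_lapl {n : ℕ} {u f : Euc n → ℝ} (hu : ContDiff ℝ 2 u)
    (hc : HasCompactSupport u) (hf : ContDiff ℝ 1 f) :
    ∫ x, f x * lapl n u x = -∫ x, ∑ i : Fin n, fderiv ℝ f x (EuclideanSpace.single i 1) *
      fderiv ℝ u x (EuclideanSpace.single i 1) := by
  have hcd : ∀ v, HasCompactSupport fun y => fderiv ℝ u y v := fun v =>
    (hc.fderiv ℝ).mono (fun x hx h => hx (by simp [h]))
  have hcdd : ∀ v, HasCompactSupport fun x => fderiv ℝ (fun y => fderiv ℝ u y v) x v := fun v =>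
    ((hcd v).fderiv ℝ).mono (fun x hx h => hx (by simp [h]))
  have h1 : ∀ v, ContDiff ℝ 1 fun y => fderiv ℝ u y v := contDiff_fderiv_apply hu
  have hdf : ∀ v, Continuous fun x => fderiv ℝ f x v := fun v =>
    (hf.continuous_fderiv one_ne_zero).clm_apply continuous_const
  have hi1 : ∀ v, Integrable fun x => f x * fderiv ℝ (fun y => fderiv ℝ u y v) x v := fun v =>
    (hf.continuous.mul (((h1 v).continuous_fderiv one_ne_zero).clm_apply
      continuous_const)).integrable_of_hasCompactSupport (hcdd v).mul_left
  have hi2 : ∀ v, Integrable fun x => fderiv ℝ f x v * fderiv ℝ u x v := fun v =>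
    ((hdf v).mul (h1 v).continuous).integrable_of_hasCompactSupport (hcd v).mul_left
  simp_rw [lapl_eq_sum_fderiv hu, Finset.mul_sum]
  rw [integral_finsetSum _ fun i _ => hi1 _, integral_finsetSum _ fun i _ => hi2 _,
    ← Finset.sum_neg_distrib]
  refine Finset.sum_congr rfl fun i _ => ?_
  exact integral_mul_fderiv_eq_neg_fderiv_mul_of_integrable (hi2 _) (hi1 _)
    ((hf.continuous.mul (h1 _).continuous).integrable_of_hasCompactSupport (hcd _).mul_left)
    (fun x _ => hf.differentiable one_ne_zero x)
    (fun x _ => (h1 _).differentiable one_ne_zero x)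

theorem integral_lapl_eq_zero {n : ℕ} {u : Euc n → ℝ} (hu : ContDiff ℝ 2 u)
    (hc : HasCompactSupport u) : ∫ x, lapl n u x = 0 := by
  simpa using integral_mul_lapl hu hc (contDiff_const (c := (1 : ℝ)))

theorem integral_comp_mul_norm_sq_fderiv {n : ℕ} {u : Euc n → ℝ} (hu : ContDiff ℝ 2 u)
    (hc : HasCompactSupport u) {G g : ℝ → ℝ} (hG : ∀ t, HasDerivAt G (g t) t)
    (hg : Continuous g) :
    ∫ x, g (u x) * ‖fderiv ℝ u x‖ ^ 2 = -∫ x, G (u x) * lapl n u x := by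
  have hG1 : ContDiff ℝ 1 G := by
    rw [contDiff_one_iff_deriv]
    refine ⟨fun t => (hG t).differentiableAt, ?_⟩
    rwa [funext fun t => (hG t).deriv]
  have h := integral_mul_lapl hu hc (hG1.comp (hu.of_le (by norm_num)))
  simp only [Function.comp_apply] at h
  rw [h, neg_neg]
  refine integral_congr_ae (Eventually.of_forall fun x => ?_)
  have hd : fderiv ℝ (G ∘ u) x = g (u x) • fderiv ℝ u x :=
    ((hG (u x)).comp_hasFDerivAt x (hu.differentiable two_ne_zero x).hasFDerivAt).fderiv
  simp only
  rw [hd, ← sum_sq_apply_single, Finset.mul_sum]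
  refine Finset.sum_congr rfl fun i _ => ?_
  simp only [FunLike.coe_smul, Pi.smul_apply, smul_eq_mul]
  ring

/-- The energy of `u` in a band of levels is controlled by half of `‖Δu‖₁`. -/
theorem integral_comp_mul_norm_sq_fderiv_le {n : ℕ} {u : Euc n → ℝ} (hu : ContDiff ℝ 2 u)
    (hc : HasCompactSupport u) {G g : ℝ → ℝ} (hG : ∀ t, HasDerivAt G (g t) t)
    (hg : Continuous g) {L : ℝ} (hG0 : ∀ t, 0 ≤ G t) (hGL : ∀ t, G t ≤ L) :
    ∫ x, g (u x) * ‖fderiv ℝ u x‖ ^ 2 ≤ (∫ x, |lapl n u x|) / 2 * L := by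
  have hi := integrable_lapl hu hc
  have hGc : Continuous G := continuous_iff_continuousAt.2 fun t => (hG t).continuousAt
  rw [integral_comp_mul_norm_sq_fderiv hu hc hG hg, ← integral_neg]
  have hI : Integrable fun x => -(G (u x) * lapl n u x) :=
    (((hGc.comp hu.continuous).mul (continuous_lapl hu)).integrable_of_hasCompactSupport
      hc.lapl.mul_left).neg
  calc ∫ x, -(G (u x) * lapl n u x) ≤ ∫ x, L / 2 * (|lapl n u x| - lapl n u x) := by
        refine integral_mono hI ((hi.abs.sub hi).const_mul _) fun x => ?_
        have h1 := neg_abs_le (lapl n u x)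
        have h2 := le_abs_self (lapl n u x)
        have h3 := hG0 (u x)
        have h4 := hGL (u x)
        simp only
        nlinarith [mul_nonneg h3 (by linarith : 0 ≤ |lapl n u x| + lapl n u x),
          mul_nonneg (by linarith : 0 ≤ L - G (u x)) (by linarith : 0 ≤ |lapl n u x| - lapl n u x)]
    _ = (∫ x, |lapl n u x|) / 2 * L := by
        rw [integral_const_mul, integral_sub hi.abs hi, integral_lapl_eq_zero hu hc]
        ring

/-! ### Decay of the distribution function -/

/-- A continuous bump on `[a, b]` which equals one on `[a + δ, b - δ]`. -/
def trapezoid (a b δ t : ℝ) : ℝ := max 0 (min 1 (min ((t - a) / δ) ((b - t) / δ)))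

theorem continuous_trapezoid (a b δ : ℝ) : Continuous (trapezoid a b δ) := by
  unfold trapezoid
  fun_prop

theorem trapezoid_nonneg (a b δ t : ℝ) : 0 ≤ trapezoid a b δ t := le_max_left _ _

theorem trapezoid_le_one (a b δ t : ℝ) : trapezoid a b δ t ≤ 1 :=
  max_le zero_le_one (min_le_left _ _)

theorem trapezoid_eq_zero_of_le {a b δ t : ℝ} (hδ : 0 < δ) (h : t ≤ a) : trapezoid a b δ t = 0 :=
  max_eq_left ((min_le_right _ _).trans ((min_le_left _ _).trans
    (div_nonpos_of_nonpos_of_nonneg (by linarith) hδ.le)))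

theorem trapezoid_eq_zero_of_ge {a b δ t : ℝ} (hδ : 0 < δ) (h : b ≤ t) : trapezoid a b δ t = 0 :=
  max_eq_left ((min_le_right _ _).trans ((min_le_right _ _).trans
    (div_nonpos_of_nonpos_of_nonneg (by linarith) hδ.le)))

theorem trapezoid_eq_one {a b δ t : ℝ} (hδ : 0 < δ) (h1 : a + δ ≤ t) (h2 : t ≤ b - δ) :
    trapezoid a b δ t = 1 := by
  have e1 : 1 ≤ (t - a) / δ := by rw [le_div_iff₀ hδ]; linarith
  have e2 : 1 ≤ (b - t) / δ := by rw [le_div_iff₀ hδ]; linarith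
  rw [trapezoid, min_eq_left (le_min e1 e2), max_eq_right zero_le_one]

theorem le_integral_trapezoid {a b δ : ℝ} (hδ : 0 < δ) (h : a + δ ≤ b - δ) :
    b - a - 2 * δ ≤ ∫ t in a..b, trapezoid a b δ t := by
  have hi : ∀ c d, IntervalIntegrable (trapezoid a b δ) volume c d := fun c d =>
    (continuous_trapezoid a b δ).intervalIntegrable c d
  rw [← intervalIntegral.integral_add_adjacent_intervals (hi a (a + δ)) (hi (a + δ) b),
    ← intervalIntegral.integral_add_adjacent_intervals (hi (a + δ) (b - δ)) (hi (b - δ) b)]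
  have h1 : 0 ≤ ∫ t in a..(a + δ), trapezoid a b δ t :=
    intervalIntegral.integral_nonneg (by linarith) fun t _ => trapezoid_nonneg _ _ _ t
  have h2 : 0 ≤ ∫ t in (b - δ)..b, trapezoid a b δ t :=
    intervalIntegral.integral_nonneg (by linarith) fun t _ => trapezoid_nonneg _ _ _ t
  have h3 : ∫ t in (a + δ)..(b - δ), trapezoid a b δ t = b - a - 2 * δ := by
    rw [intervalIntegral.integral_congr (g := fun _ => (1 : ℝ)) fun t ht => by
      rw [Set.uIcc_of_le h] at ht
      exact trapezoid_eq_one hδ ht.1 ht.2]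
    simp only [intervalIntegral.integral_const, smul_eq_mul]
    ring
  linarith

theorem sq_integral_mul_le {α : Type*} [MeasurableSpace α] {μ : Measure α} {g v : α → ℝ}
    (hg : ∀ x, 0 ≤ g x) (h0 : Integrable g μ) (h1 : Integrable (fun x => g x * v x) μ)
    (h2 : Integrable (fun x => g x * v x ^ 2) μ) :
    (∫ x, g x * v x ∂μ) ^ 2 ≤ (∫ x, g x * v x ^ 2 ∂μ) * ∫ x, g x ∂μ := by
  have key : ∀ r : ℝ, 0 ≤ (∫ x, g x * v x ^ 2 ∂μ) * (r * r) + (-2 * ∫ x, g x * v x ∂μ) * r +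
      ∫ x, g x ∂μ := by
    intro r
    have h : 0 ≤ ∫ x, (r ^ 2 * (g x * v x ^ 2) - 2 * r * (g x * v x)) + g x ∂μ :=
      integral_nonneg fun x => by
        have := mul_nonneg (hg x) (sq_nonneg (r * v x - 1))
        simp only [Pi.zero_apply]
        linarith
    have hs : Integrable (fun x => r ^ 2 * (g x * v x ^ 2) - 2 * r * (g x * v x)) μ :=
      (h2.const_mul _).sub (h1.const_mul _)
    rw [integral_add hs h0,
      integral_sub (h2.const_mul _) (h1.const_mul _), integral_const_mul,
      integral_const_mul] at h
    linarith
  have := discrim_le_zero key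
  rw [discrim] at this
  linarith

/-- The difference inequality satisfied by the distribution function of `u`. -/
theorem distribution_difference_le {n : ℕ} (hn : n ≠ 0) {q : ℝ} (hq0 : 0 ≤ q)
    (hq : ENNReal.ofReal (q ^ n) ≤ volume (Metric.ball (0 : Euc n) 1)) {u : Euc n → ℝ}
    (hu : ContDiff ℝ 2 u) (hc : HasCompactSupport u) {a b P : ℝ} (ha : 0 ≤ a) (hab : a < b)
    (hP : 0 < P) (hPb : ENNReal.ofReal (P ^ n) ≤ volume {x | b < u x}) :
    (n * P ^ (n - 1) * q) ^ 2 * (b - a) ≤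
      (∫ x, |lapl n u x|) / 2 * (volume.real {x | a < u x} - volume.real {x | b < u x}) := by
  set m := (∫ x, |lapl n u x|) / 2
  set μ : ℝ → ℝ := fun t => volume.real {x | t < u x}
  change _ ≤ m * (μ a - μ b)
  suffices H : ∀ δ, 0 < δ → 2 * δ < b - a →
      (n * P ^ (n - 1) * q) ^ 2 * (b - a - 2 * δ) ≤ m * (μ a - μ b) by
    refine le_of_tendsto (f := fun δ => (n * P ^ (n - 1) * q) ^ 2 * (b - a - 2 * δ))
      (x := 𝓝[>] 0) ?_ ?_
    · refine tendsto_nhdsWithin_of_tendsto_nhds ?_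
      have : Continuous fun δ : ℝ => (n * P ^ (n - 1) * q) ^ 2 * (b - a - 2 * δ) := by fun_prop
      simpa using this.tendsto 0
    · have : Set.Ioo 0 ((b - a) / 2) ∈ 𝓝[>] (0 : ℝ) := Ioo_mem_nhdsGT (by linarith)
      filter_upwards [this] with δ hδ
      exact H δ hδ.1 (by linarith [hδ.2])
  intro δ hδ hδab
  set g := trapezoid a b δ
  have hg : Continuous g := continuous_trapezoid a b δ
  set G : ℝ → ℝ := fun t => ∫ s in a..t, g s
  have hG : ∀ t, HasDerivAt G (g t) t := fun t =>
    intervalIntegral.integral_hasDerivAt_right (hg.intervalIntegrable _ _)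
      (hg.stronglyMeasurableAtFilter _ _) hg.continuousAt
  have hGmono : Monotone G := monotone_of_deriv_nonneg (fun t => (hG t).differentiableAt)
    fun t => by rw [(hG t).deriv]; exact trapezoid_nonneg _ _ _ _
  have hGa : ∀ t ≤ a, G t = 0 := by
    intro t ht
    simp only [G]
    rw [intervalIntegral.integral_congr (g := fun _ => (0 : ℝ)) fun s hs => by
      rw [Set.uIcc_of_ge ht] at hs
      exact trapezoid_eq_zero_of_le hδ hs.2]
    simp
  have hGb : ∀ t, b ≤ t → G t = G b := by
    intro t ht
    simp only [G]
    rw [← intervalIntegral.integral_add_adjacent_intervals (hg.intervalIntegrable a b)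
      (hg.intervalIntegrable b t), intervalIntegral.integral_congr (a := b) (b := t)
      (g := fun _ => (0 : ℝ)) fun s hs => by
        rw [Set.uIcc_of_le ht] at hs
        exact trapezoid_eq_zero_of_ge hδ hs.1]
    simp
  have hG0 : ∀ t, 0 ≤ G t := by
    intro t
    rcases le_total t a with h | h
    · exact (hGa t h).ge
    · rw [← hGa a le_rfl]; exact hGmono h
  have hGL : ∀ t, G t ≤ G b := by
    intro t
    rcases le_total t b with h | h
    · exact hGmono h
    · exact (hGb t h).le
  have hL : b - a - 2 * δ ≤ G b := le_integral_trapezoid hδ (by linarith)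
  have hLpos : 0 < G b := by linarith
  have hG1 : ContDiff ℝ 1 G := by
    rw [contDiff_one_iff_deriv]
    refine ⟨fun t => (hG t).differentiableAt, ?_⟩
    rwa [funext fun t => (hG t).deriv]
  have hg0 : g 0 = 0 := trapezoid_eq_zero_of_le hδ ha
  have hdw : ∀ x, fderiv ℝ (G ∘ u) x = g (u x) • fderiv ℝ u x := fun x =>
    ((hG (u x)).comp_hasFDerivAt x (hu.differentiable two_ne_zero x).hasFDerivAt).fderiv
  have hI := mul_le_integral_norm_fderiv hn hq0 hq (w := G ∘ u)
    (hG1.comp (hu.of_le (by norm_num))) (hc.comp_left (hGa 0 ha)) (fun x => hG0 _) (L := G b)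
    hLpos.le hP (fun t _ ht => hPb.trans (measure_mono fun x hx => by
      have : G (u x) = G b := hGb _ (le_of_lt hx)
      simpa [this] using ht))
  have e1 : ∫ x, ‖fderiv ℝ (G ∘ u) x‖ = ∫ x, g (u x) * ‖fderiv ℝ u x‖ := by
    refine integral_congr_ae (Eventually.of_forall fun x => ?_)
    simp only [hdw, norm_smul, Real.norm_eq_abs, abs_of_nonneg (trapezoid_nonneg a b δ (u x)), g]
  rw [e1] at hI
  have hgc : HasCompactSupport fun x => g (u x) := hc.comp_left hg0
  have hgu : Continuous fun x => g (u x) := hg.comp hu.continuous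
  have hdu : Continuous fun x => ‖fderiv ℝ u x‖ := (hu.continuous_fderiv two_ne_zero).norm
  have hgi : Integrable fun x => g (u x) := hgu.integrable_of_hasCompactSupport hgc
  have hCS := sq_integral_mul_le (μ := volume) (g := fun x => g (u x))
    (v := fun x => ‖fderiv ℝ u x‖) (fun x => trapezoid_nonneg _ _ _ _) hgi
    ((hgu.mul hdu).integrable_of_hasCompactSupport hgc.mul_right)
    ((hgu.mul (hdu.pow 2)).integrable_of_hasCompactSupport hgc.mul_right)
  have hE := integral_comp_mul_norm_sq_fderiv_le hu hc hG hg hG0 hGL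
  have hmeas : ∀ t, MeasurableSet {x | t < u x} := fun t =>
    (isOpen_lt continuous_const hu.continuous).measurableSet
  have hfin : ∀ t, 0 ≤ t → volume {x | t < u x} ≠ ∞ := fun t ht =>
    ((measure_mono fun x hx => subset_tsupport u
      (ne_of_gt (lt_of_le_of_lt ht hx))).trans_lt hc.measure_lt_top).ne
  have hsub : {x | b < u x} ⊆ {x | a < u x} := fun x hx => hab.trans hx
  have hgle : ∫ x, g (u x) ≤ μ a - μ b := by
    have hm := (hmeas a).diff (hmeas b)
    have hf : volume ({x | a < u x} \ {x | b < u x}) ≠ ∞ :=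
      ((measure_mono Set.sdiff_subset).trans_lt (hfin a ha).lt_top).ne
    calc ∫ x, g (u x) ≤ ∫ x, ({x | a < u x} \ {x | b < u x}).indicator (fun _ => (1 : ℝ)) x := by
          refine integral_mono hgi ((integrable_indicator_iff hm).2
            (integrableOn_const hf)) fun x => ?_
          by_cases hx : x ∈ {x | a < u x} \ {x | b < u x}
          · rw [Set.indicator_of_mem hx]
            exact trapezoid_le_one _ _ _ _
          · rw [Set.indicator_of_notMem hx]
            by_cases h1 : a < u x
            · have h2 : b < u x := by
                by_contra h2
                exact hx ⟨h1, h2⟩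
              exact (trapezoid_eq_zero_of_ge hδ h2.le).le
            · exact (trapezoid_eq_zero_of_le hδ (not_lt.1 h1)).le
      _ = μ a - μ b := by
          rw [integral_indicator_const _ hm, smul_eq_mul, mul_one, measureReal_sdiff hsub (hmeas b) (hfin a ha)]
  have hm0 : 0 ≤ m := div_nonneg (integral_nonneg fun x => abs_nonneg _) zero_le_two
  have hK : 0 ≤ n * P ^ (n - 1) * q := by positivity
  have h1 : (n * P ^ (n - 1) * q * G b) ^ 2 ≤ m * G b * (μ a - μ b) :=
    calc (n * P ^ (n - 1) * q * G b) ^ 2 ≤ (∫ x, g (u x) * ‖fderiv ℝ u x‖) ^ 2 :=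
          pow_le_pow_left₀ (mul_nonneg hK hLpos.le) hI 2
      _ ≤ (∫ x, g (u x) * ‖fderiv ℝ u x‖ ^ 2) * ∫ x, g (u x) := hCS
      _ ≤ m * G b * (μ a - μ b) := mul_le_mul hE hgle
          (integral_nonneg fun x => trapezoid_nonneg _ _ _ _) (mul_nonneg hm0 hLpos.le)
  have h2 : (n * P ^ (n - 1) * q) ^ 2 * G b ≤ m * (μ a - μ b) := by
    refine le_of_mul_le_mul_right ?_ hLpos
    linarith
  exact (mul_le_mul_of_nonneg_left hL (sq_nonneg _)).trans h2

/-! ### From the difference inequality to the weak-type estimate -/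

theorem rpow_neg_tangent_le {p x y : ℝ} (hp : 0 < p) (hx : 0 < x) (hy : 0 < y) :
    y ^ (-p) + p * y ^ (-p - 1) * (y - x) ≤ x ^ (-p) := by
  have h1 : 1 - p * (x / y - 1) ≤ (x / y) ^ (-p) := by
    have hr : 0 < x / y := div_pos hx hy
    have h2 := Real.log_le_sub_one_of_pos hr
    have h3 := Real.add_one_le_exp (Real.log (x / y) * -p)
    rw [Real.rpow_def_of_pos hr]
    nlinarith
  rw [Real.div_rpow hx.le hy.le, le_div_iff₀ (Real.rpow_pos_of_pos hy _)] at h1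
  refine le_trans (le_of_eq ?_) h1
  rw [Real.rpow_sub_one hy.ne']
  field_simp
  ring

/-- A right-continuous decreasing function with `-μ' ≥ k μ ^ (p + 1)` satisfies
`(μ ^ (-p))' ≥ p k`. -/
theorem mul_le_rpow_neg_of_difference_le {μ : ℝ → ℝ} (hanti : ∀ a b, 0 ≤ a → a ≤ b → μ b ≤ μ a)
    (hright : ∀ t v, 0 ≤ t → v < μ t → ∃ b, t < b ∧ v < μ b) {s k p : ℝ} (hs : 0 ≤ s) (hk : 0 < k)
    (hp : 0 < p) (hμ : 0 < μ s)
    (h : ∀ a b, 0 ≤ a → a < b → b ≤ s → k * (b - a) * μ b ^ (p + 1) ≤ μ a - μ b) :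
    p * k * s ≤ μ s ^ (-p) := by
  have hpos : ∀ t, 0 ≤ t → t ≤ s → 0 < μ t := fun t h0 ht => hμ.trans_le (hanti t s h0 ht)
  suffices H : ∀ c, 0 < c → c < p * k → c * s ≤ μ s ^ (-p) by
    have hpk : 0 < p * k := mul_pos hp hk
    refine le_of_tendsto (f := fun c => c * s) (x := 𝓝[<] (p * k)) ?_ ?_
    · exact tendsto_nhdsWithin_of_tendsto_nhds
        ((continuous_id.mul continuous_const).tendsto (p * k))
    · filter_upwards [Ioo_mem_nhdsLT hpk] with c hc using H c hc.1 hc.2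
  intro c hc0 hc
  set T := {τ : ℝ | 0 ≤ τ ∧ τ ≤ s ∧ c * τ ≤ μ τ ^ (-p)}
  have h0 : (0 : ℝ) ∈ T := ⟨le_rfl, hs, by
    rw [mul_zero]; exact (Real.rpow_pos_of_pos (hpos 0 le_rfl hs) _).le⟩
  have hb : BddAbove T := ⟨s, fun τ hτ => hτ.2.1⟩
  set σ := sSup T
  have hσ0 : 0 ≤ σ := le_csSup hb h0
  have hσs : σ ≤ s := csSup_le ⟨0, h0⟩ fun τ hτ => hτ.2.1
  have hσ : c * σ ≤ μ σ ^ (-p) := by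
    rw [mul_comm, ← le_div_iff₀ hc0]
    refine csSup_le ⟨0, h0⟩ fun τ hτ => ?_
    rw [le_div_iff₀ hc0, mul_comm]
    exact hτ.2.2.trans (Real.rpow_le_rpow_of_nonpos (hpos σ hσ0 hσs) (hanti _ _ hτ.1 (le_csSup hb hτ))
      (by linarith))
  rcases hσs.eq_or_lt with he | hlt
  · rwa [he] at hσ
  exfalso
  have hy := hpos σ hσ0 hσs
  have hr0 : 0 < c / (p * k) := by positivity
  have hr1 : c / (p * k) < 1 := (div_lt_one (by positivity)).2 hc
  have hp1 : 0 < p + 1 := by linarith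
  have hv : μ σ * (c / (p * k)) ^ (1 / (p + 1)) < μ σ :=
    mul_lt_of_lt_one_right hy (Real.rpow_lt_one hr0.le hr1 (by positivity))
  obtain ⟨b₀, hb₀, hvb⟩ := hright _ _ hσ0 hv
  set b := min b₀ s
  have hσb : σ < b := lt_min hb₀ hlt
  have hbs : b ≤ s := min_le_right _ _
  have hx := hpos b (hσ0.trans hσb.le) hbs
  have hvx : μ σ * (c / (p * k)) ^ (1 / (p + 1)) ≤ μ b := hvb.le.trans (hanti _ _ (hσ0.trans hσb.le) (min_le_left _ _))
  have hvp : μ σ ^ (p + 1) * (c / (p * k)) ≤ μ b ^ (p + 1) := by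
    have := Real.rpow_le_rpow (by positivity) hvx hp1.le
    rwa [Real.mul_rpow hy.le (by positivity), ← Real.rpow_mul hr0.le,
      one_div_mul_cancel hp1.ne', Real.rpow_one] at this
  have hd := h σ b hσ0 hσb hbs
  have ht := rpow_neg_tangent_le hp hx hy
  have hbT : b ∈ T := by
    refine ⟨hσ0.trans hσb.le, hbs, le_trans ?_ ht⟩
    have h1 : c * (b - σ) ≤ p * μ σ ^ (-p - 1) * (μ σ - μ b) := by
      have e : μ σ ^ (-p - 1) * μ σ ^ (p + 1) = 1 := by
        rw [← Real.rpow_add hy]; norm_num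
      calc c * (b - σ) = p * μ σ ^ (-p - 1) * (k * (b - σ) * (μ σ ^ (p + 1) * (c / (p * k)))) := by
            have : p * μ σ ^ (-p - 1) * (k * (b - σ) * (μ σ ^ (p + 1) * (c / (p * k)))) =
              (μ σ ^ (-p - 1) * μ σ ^ (p + 1)) * (p * k * (c / (p * k))) * (b - σ) := by ring
            rw [this, e, mul_div_cancel₀ _ (by positivity), one_mul]
        _ ≤ p * μ σ ^ (-p - 1) * (k * (b - σ) * μ b ^ (p + 1)) := by
            have : 0 < b - σ := by linarith
            gcongr
        _ ≤ _ := by gcongr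
    linarith
  exact absurd (le_csSup hb hbT) (not_le.2 hσb)

theorem exists_gt_lt_volume_real_superlevel {α : Type*} [MeasurableSpace α] {μ : Measure α}
    (u : α → ℝ) (t v : ℝ) (hv : v < μ.real {x | t < u x}) (hfin : μ {x | t < u x} ≠ ∞) :
    ∃ b, t < b ∧ v < μ.real {x | b < u x} := by
  have hmono : Monotone fun k : ℕ => {x | t + 1 / ((k : ℝ) + 1) < u x} := by
    intro i j hij x hx
    have : 1 / ((j : ℝ) + 1) ≤ 1 / ((i : ℝ) + 1) := Nat.one_div_le_one_div hij
    simp only [Set.mem_ofPred_eq] at hx ⊢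
    linarith
  have hU : {x | t < u x} = ⋃ k : ℕ, {x | t + 1 / ((k : ℝ) + 1) < u x} := by
    ext x
    simp only [Set.mem_iUnion, Set.mem_ofPred_eq]
    constructor
    · intro hx
      obtain ⟨k, hk⟩ := exists_nat_one_div_lt (sub_pos.2 hx)
      exact ⟨k, by linarith⟩
    · rintro ⟨k, hk⟩
      have : 0 < 1 / ((k : ℝ) + 1) := Nat.one_div_pos_of_nat
      linarith
  have hlim := tendsto_measure_iUnion_atTop (μ := μ) hmono
  rw [← hU] at hlim
  have h2 := (ENNReal.tendsto_toReal hfin).comp hlim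
  obtain ⟨k, hk⟩ := (h2.eventually (lt_mem_nhds hv)).exists
  exact ⟨_, lt_add_of_pos_right t Nat.one_div_pos_of_nat, hk⟩

/-! ### The weak-type estimate for test functions -/

theorem omegaS_pos {n : ℕ} (hn : n ≠ 0) : 0 < omegaS n := by
  have : (0 : ℝ) < n := by positivity
  have := Real.Gamma_pos_of_pos (half_pos this)
  unfold omegaS
  positivity

theorem volume_real_ball {n : ℕ} (hn : n ≠ 0) (x : Euc n) {r : ℝ} (hr : 0 ≤ r) :
    volume.real (Metric.ball x r) = omegaS n / n * r ^ n := by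
  have : Nonempty (Fin n) := ⟨⟨0, Nat.pos_of_ne_zero hn⟩⟩
  have hn' : (n : ℝ) ≠ 0 := Nat.cast_ne_zero.2 hn
  have hG : 0 < Real.Gamma ((n : ℝ) / 2) := Real.Gamma_pos_of_pos (by positivity)
  have hG1 : Real.Gamma ((n : ℝ) / 2 + 1) = n / 2 * Real.Gamma ((n : ℝ) / 2) :=
    Real.Gamma_add_one (by positivity)
  have hpi : √Real.pi ^ n = Real.pi ^ ((n : ℝ) / 2) := by
    rw [Real.sqrt_eq_rpow, ← Real.rpow_natCast, ← Real.rpow_mul Real.pi_pos.le]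
    congr 1
    ring
  rw [measureReal_def, EuclideanSpace.volume_ball, Fintype.card_fin, ENNReal.toReal_mul,
    ENNReal.toReal_pow, ENNReal.toReal_ofReal hr, ENNReal.toReal_ofReal
      (div_nonneg (by positivity) (by rw [hG1]; positivity)), hG1, hpi, omegaS]
  field_simp

theorem volume_ball_eq_ofReal {n : ℕ} (hn : n ≠ 0) (x : Euc n) {r : ℝ} (hr : 0 ≤ r) :
    volume (Metric.ball x r) = ENNReal.ofReal (omegaS n / n * r ^ n) := by
  rw [← volume_real_ball hn x hr, measureReal_def, ENNReal.ofReal_toReal measure_ball_lt_top.ne]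

theorem volume_superlevel_ne_top {n : ℕ} {u : Euc n → ℝ} (hc : HasCompactSupport u) {t : ℝ}
    (ht : 0 ≤ t) : volume {x | t < u x} ≠ ∞ :=
  ((measure_mono fun _ hx => subset_tsupport u
    (ne_of_gt (lt_of_le_of_lt ht hx))).trans_lt hc.measure_lt_top).ne

theorem mul_rpow_volume_superlevel_le {n : ℕ} (hn : 3 ≤ n) {u : Euc n → ℝ} (hu : ContDiff ℝ 2 u)
    (hc : HasCompactSupport u) {s : ℝ} (hs : 0 < s) :
    s * volume.real {x | s < u x} ^ (((n : ℝ) - 2) / n) ≤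
      (∫ x, |lapl n u x|) / 2 / (n * (n - 2) * (omegaS n / n) ^ (2 / (n : ℝ))) := by
  have hn0 : n ≠ 0 := by omega
  have hn3 : (3 : ℝ) ≤ n := by exact_mod_cast hn
  have hn2 : (0 : ℝ) < n - 2 := by linarith
  have hnp : (0 : ℝ) < n := by linarith
  set κ := omegaS n / n
  have hκ : 0 < κ := div_pos (omegaS_pos hn0) hnp
  set p := ((n : ℝ) - 2) / n with hp_def
  have hp : 0 < p := div_pos hn2 hnp
  set m := (∫ x, |lapl n u x|) / 2
  have hm0 : 0 ≤ m := div_nonneg (integral_nonneg fun x => abs_nonneg _) zero_le_two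
  set μ : ℝ → ℝ := fun t => volume.real {x | t < u x}
  change s * μ s ^ p ≤ _
  set D := n * (n - 2) * κ ^ (2 / (n : ℝ)) with hD_def
  have hD : 0 < D := by positivity
  have hμ0 : 0 ≤ μ s := measureReal_nonneg
  rcases hμ0.eq_or_lt with h0 | hμs
  · rw [← h0, Real.zero_rpow hp.ne', mul_zero]
    positivity
  have hfin : ∀ t, 0 ≤ t → volume {x | t < u x} ≠ ∞ := fun t ht => volume_superlevel_ne_top hc ht
  have hanti : ∀ a b, 0 ≤ a → a ≤ b → μ b ≤ μ a := fun a b ha hab =>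
    measureReal_mono (fun x hx => lt_of_le_of_lt hab hx) (hfin a ha)
  have hroot : ∀ y : ℝ, 0 ≤ y → (y ^ (1 / (n : ℝ))) ^ n = y := fun y hy => by
    rw [← Real.rpow_natCast, ← Real.rpow_mul hy, one_div_mul_cancel hnp.ne', Real.rpow_one]
  have hdiff : ∀ a b, 0 ≤ a → a < b → b ≤ s →
      n ^ 2 * κ ^ (2 / (n : ℝ)) * (b - a) * μ b ^ (p + 1) ≤ m * (μ a - μ b) := by
    intro a b ha hab hb
    have hμb : 0 < μ b := hμs.trans_le (hanti b s (ha.trans hab.le) hb)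
    have h := distribution_difference_le hn0 (q := κ ^ (1 / (n : ℝ))) (by positivity)
      (by rw [hroot _ hκ.le, volume_ball_eq_ofReal hn0 _ zero_le_one]; simp [κ]) hu hc
      (P := μ b ^ (1 / (n : ℝ))) ha hab (by positivity)
      (by rw [hroot _ hμb.le]; exact ENNReal.ofReal_toReal_le)
    refine le_trans (le_of_eq ?_) h
    have e1 : ((μ b ^ (1 / (n : ℝ))) ^ (n - 1)) ^ 2 = μ b ^ (p + 1) := by
      rw [← pow_mul, ← Real.rpow_natCast, ← Real.rpow_mul hμb.le]
      congr 1
      rw [hp_def, Nat.cast_mul, Nat.cast_sub (by omega)]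
      field_simp
      push_cast
      ring
    have e2 : (κ ^ (1 / (n : ℝ))) ^ 2 = κ ^ (2 / (n : ℝ)) := by
      rw [← Real.rpow_natCast, ← Real.rpow_mul hκ.le]
      congr 1
      push_cast
      ring
    rw [mul_pow, mul_pow, e1, e2]
    ring
  have hm : 0 < m := by
    refine hm0.lt_of_ne fun h => ?_
    have := hdiff 0 s le_rfl hs le_rfl
    rw [← h, zero_mul, sub_zero] at this
    exact absurd this (not_le.2 (by positivity))
  have key := mul_le_rpow_neg_of_difference_le (μ := μ) hanti
    (fun t v ht hv => exists_gt_lt_volume_real_superlevel u t v hv (hfin t ht)) hs.le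
    (k := n ^ 2 * κ ^ (2 / (n : ℝ)) / m) (by positivity) hp hμs (fun a b ha hab hb => by
      have := hdiff a b ha hab hb
      rw [← div_le_iff₀' hm] at this
      refine le_trans (le_of_eq ?_) this
      ring)
  rw [Real.rpow_neg hμs.le] at key
  have hM : 0 < μ s ^ p := Real.rpow_pos_of_pos hμs _
  rw [le_inv_comm₀ (by positivity) hM] at key
  calc s * μ s ^ p ≤ s * (p * (n ^ 2 * κ ^ (2 / (n : ℝ)) / m) * s)⁻¹ := by gcongr
    _ = m / D := by
      rw [hp_def, hD_def]
      field_simp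

/-- The sharp constant of the weak-type inequality. -/
def sharpConst (n : ℕ) : ℝ :=
  (2 : ℝ) ^ (-(2 / (n : ℝ))) * cConst n * (omegaS n / (n : ℝ)) ^ (((n : ℝ) - 2) / (n : ℝ))

theorem sharpConst_eq {n : ℕ} (hn : 3 ≤ n) :
    sharpConst n = (2 * (omegaS n / n)) ^ (((n : ℝ) - 2) / n) /
      (2 * (n * (n - 2) * (omegaS n / n))) := by
  have hn3 : (3 : ℝ) ≤ n := by exact_mod_cast hn
  have hn2 : (0 : ℝ) < n - 2 := by linarith
  have hnp : (0 : ℝ) < n := by linarith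
  have hω := omegaS_pos (n := n) (by omega)
  have e : (2 : ℝ) ^ (-(2 / (n : ℝ))) = 2 ^ (((n : ℝ) - 2) / n) / 2 := by
    rw [← Real.rpow_sub_one two_ne_zero]
    congr 1
    field_simp
    ring
  rw [sharpConst, cConst, Real.mul_rpow zero_le_two (by positivity), e]
  field_simp

theorem sharpConst_pos {n : ℕ} (hn : 3 ≤ n) : 0 < sharpConst n := by
  have hn3 : (3 : ℝ) ≤ n := by exact_mod_cast hn
  have hn2 : (0 : ℝ) < n - 2 := by linarith
  have hω := omegaS_pos (n := n) (by omega)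
  rw [sharpConst_eq hn]
  positivity

theorem lapl_neg (n : ℕ) (u : Euc n → ℝ) : lapl n (-u) = -lapl n u := by
  ext x
  simp [lapl, iteratedFDeriv_neg_apply]

theorem mul_rpow_volume_abs_superlevel_le {n : ℕ} (hn : 3 ≤ n) {u : Euc n → ℝ}
    (hu : ContDiff ℝ 2 u) (hc : HasCompactSupport u) {s : ℝ} (hs : 0 < s) :
    s * volume.real {x | s < |u x|} ^ (((n : ℝ) - 2) / n) ≤
      sharpConst n * ∫ x, |lapl n u x| := by
  have hn3 : (3 : ℝ) ≤ n := by exact_mod_cast hn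
  have hn2 : (0 : ℝ) < n - 2 := by linarith
  have hnp : (0 : ℝ) < n := by linarith
  have hω := omegaS_pos (n := n) (by omega)
  have h1 := mul_rpow_volume_superlevel_le hn hu hc hs
  have h2 := mul_rpow_volume_superlevel_le hn hu.neg (u := -u) (hc.comp_left neg_zero) hs
  simp only [lapl_neg, Pi.neg_apply, abs_neg] at h2
  set p := ((n : ℝ) - 2) / n with hp_def
  have hp : 0 < p := div_pos hn2 hnp
  set A := volume.real {x | s < u x}
  set B := volume.real {x | s < -u x}
  have hA : 0 ≤ A := measureReal_nonneg
  have hB : 0 ≤ B := measureReal_nonneg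
  have hle : volume.real {x | s < |u x|} ≤ A + B := by
    have : {x | s < |u x|} = {x | s < u x} ∪ {x | s < -u x} := by
      ext x
      simp [lt_abs]
    rw [this]
    exact measureReal_union_le _ _
  have hmax : volume.real {x | s < |u x|} ≤ 2 * max A B := by
    have := le_max_left A B
    have := le_max_right A B
    linarith
  have hY : s * max A B ^ p ≤
      (∫ x, |lapl n u x|) / 2 / (n * (n - 2) * (omegaS n / n) ^ (2 / (n : ℝ))) := by
    rcases max_choice A B with h | h <;> rw [h] <;> assumption
  calc s * volume.real {x | s < |u x|} ^ p ≤ s * (2 * max A B) ^ p := by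
        gcongr
    _ = 2 ^ p * (s * max A B ^ p) := by
        rw [Real.mul_rpow zero_le_two (le_max_of_le_left hA)]
        ring
    _ ≤ 2 ^ p * ((∫ x, |lapl n u x|) / 2 / (n * (n - 2) * (omegaS n / n) ^ (2 / (n : ℝ)))) := by
        gcongr
    _ = sharpConst n * ∫ x, |lapl n u x| := by
        have hκ : 0 < omegaS n / n := by positivity
        have e : (omegaS n / n) ^ p = omegaS n / n / (omegaS n / n) ^ (2 / (n : ℝ)) := by
          rw [eq_div_iff (by positivity), ← Real.rpow_add hκ,
            show p + 2 / (n : ℝ) = 1 by rw [hp_def]; field_simp; ring, Real.rpow_one]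
        rw [sharpConst_eq hn, Real.mul_rpow zero_le_two hκ.le, e, ← hp_def]
        generalize (2 : ℝ) ^ p = a
        field_simp

/-! ### The weak-type estimate on `W^{2,1}_{Δ,0}` -/

theorem tendsto_setIntegral_abs {α : Type*} [MeasurableSpace α] {μ : Measure α} {h : ℕ → α → ℝ}
    {f : α → ℝ} (hh : ∀ k, Integrable (h k) μ) (hf : Integrable f μ)
    (hlim : Tendsto (fun k => ∫ x, |h k x - f x| ∂μ) atTop (𝓝 0)) :
    Tendsto (fun k => ∫ x, |h k x| ∂μ) atTop (𝓝 (∫ x, |f x| ∂μ)) := by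
  rw [tendsto_iff_dist_tendsto_zero]
  refine squeeze_zero (fun _ => dist_nonneg) (fun k => ?_) hlim
  rw [Real.dist_eq, ← integral_sub (hh k).abs hf.abs]
  exact (abs_integral_le_integral_abs).trans
    (integral_mono ((hh k).abs.sub hf.abs).abs ((hh k).sub hf).abs
      fun x => abs_abs_sub_abs_le _ _)

theorem IsTestFun.contDiff_two {n : ℕ} {Ω : Set (Euc n)} {φ : Euc n → ℝ}
    (h : IsTestFun n Ω φ) : ContDiff ℝ 2 φ :=
  contDiff_infty.1 h.1 2

theorem IsTestFun.setIntegral_abs_lapl {n : ℕ} {Ω : Set (Euc n)} {φ : Euc n → ℝ}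
    (h : IsTestFun n Ω φ) : ∫ x in Ω, |lapl n φ x| = ∫ x, |lapl n φ x| :=
  setIntegral_eq_integral_of_forall_compl_eq_zero fun x hx => by
    rw [abs_eq_zero]
    by_contra h0
    exact hx (h.2.2 (tsupport_lapl_subset φ (subset_tsupport _ h0)))

theorem MemW21Delta0.mul_rpow_volume_le {n : ℕ} (hn : 3 ≤ n) {Ω : Set (Euc n)} (hΩ : IsOpen Ω)
    (hb : Bornology.IsBounded Ω) {u f : Euc n → ℝ} (h : MemW21Delta0 n Ω u f) {s : ℝ}
    (hs : 0 < s) :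
    s * volume.real {x ∈ Ω | s < |u x|} ^ (((n : ℝ) - 2) / n) ≤
      sharpConst n * L1norm n Ω f := by
  obtain ⟨hu, hf, φ, hφ, hφu, hφf⟩ := h
  have hn3 : (3 : ℝ) ≤ n := by exact_mod_cast hn
  set p := ((n : ℝ) - 2) / n with hp_def
  have hp : 0 < p := div_pos (by linarith) (by linarith)
  set M := volume.real {x ∈ Ω | s < |u x|}
  have hM : 0 ≤ M := measureReal_nonneg
  have hC := sharpConst_pos hn
  have hfinΩ : volume Ω ≠ ∞ := hb.measure_lt_top.ne
  have hN : Tendsto (fun k => ∫ x, |lapl n (φ k) x|) atTop (𝓝 (L1norm n Ω f)) := by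
    simp_rw [← fun k => (hφ k).setIntegral_abs_lapl]
    exact tendsto_setIntegral_abs
      (fun k => (integrable_lapl (hφ k).contDiff_two (hφ k).2.1).integrableOn) hf hφf
  have hN0 : 0 ≤ L1norm n Ω f := integral_nonneg fun x => abs_nonneg _
  have hφi : ∀ k, IntegrableOn (fun x => |φ k x - u x|) Ω := fun k =>
    (((hφ k).1.continuous.integrable_of_hasCompactSupport (hφ k).2.1).integrableOn.sub hu).abs
  have step : ∀ ε, 0 < ε → ε < s →
      M ≤ (sharpConst n * L1norm n Ω f / (s - ε)) ^ (1 / p) := by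
    intro ε hε hεs
    have hsε : 0 < s - ε := by linarith
    have hlim : Tendsto (fun k => (sharpConst n * (∫ x, |lapl n (φ k) x|) / (s - ε)) ^ (1 / p) +
        (∫ x in Ω, |φ k x - u x|) / ε) atTop
        (𝓝 ((sharpConst n * L1norm n Ω f / (s - ε)) ^ (1 / p) + 0 / ε)) :=
      (((hN.const_mul _).div_const _).rpow_const (Or.inr (by positivity))).add
        (hφu.div_const _)
    rw [zero_div, add_zero] at hlim
    refine ge_of_tendsto' hlim fun k => ?_
    have hA := mul_rpow_volume_abs_superlevel_le hn (hφ k).contDiff_two (hφ k).2.1 hsε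
    rw [← le_div_iff₀' hsε, ← hp_def] at hA
    have hA' := Real.rpow_le_rpow (by positivity) hA (z := 1 / p) (by positivity)
    rw [← Real.rpow_mul measureReal_nonneg, mul_one_div_cancel hp.ne', Real.rpow_one] at hA'
    have hB := mul_meas_ge_le_integral_of_nonneg
      (Eventually.of_forall fun x => abs_nonneg _) (hφi k) ε
    rw [← le_div_iff₀' hε, measureReal_def, Measure.restrict_apply' hΩ.measurableSet,
      ← measureReal_def] at hB
    refine le_trans ?_ (add_le_add hA' hB)
    refine (measureReal_mono (fun x hx => ?_) ?_).trans (measureReal_union_le _ _)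
    · by_cases h1 : ε ≤ |φ k x - u x|
      · exact Or.inr ⟨h1, hx.1⟩
      · refine Or.inl ?_
        have h2 := hx.2
        have h3 := abs_sub_abs_le_abs_sub (u x) (φ k x)
        rw [abs_sub_comm] at h3
        simp only [Set.mem_ofPred_eq]
        linarith
    · refine measure_union_ne_top ?_ ((measure_mono Set.inter_subset_right).trans_lt
        hfinΩ.lt_top).ne
      exact ((measure_mono fun x hx => subset_tsupport (φ k)
        (abs_pos.1 (hsε.trans hx))).trans_lt (hφ k).2.1.measure_lt_top).ne
  have hlim : Tendsto (fun ε => (sharpConst n * L1norm n Ω f / (s - ε)) ^ (1 / p)) (𝓝[>] 0)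
      (𝓝 ((sharpConst n * L1norm n Ω f / (s - 0)) ^ (1 / p))) :=
    tendsto_nhdsWithin_of_tendsto_nhds <| (tendsto_const_nhds.div
      (tendsto_const_nhds.sub tendsto_id) (by linarith)).rpow_const (Or.inr (by positivity))
  have hfinal : M ≤ (sharpConst n * L1norm n Ω f / (s - 0)) ^ (1 / p) := by
    refine ge_of_tendsto hlim ?_
    filter_upwards [Ioo_mem_nhdsGT hs] with ε hε using step ε hε.1 hε.2
  have h2 := Real.rpow_le_rpow hM hfinal hp.le
  rw [sub_zero, ← Real.rpow_mul (by positivity), one_div_mul_cancel hp.ne', Real.rpow_one,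
    le_div_iff₀' hs] at h2
  exact h2

theorem MemW21Delta0.rpow_mul_decRearr_le {n : ℕ} (hn : 3 ≤ n) {Ω : Set (Euc n)}
    (hΩ : IsOpen Ω) (hb : Bornology.IsBounded Ω) {u f : Euc n → ℝ} (h : MemW21Delta0 n Ω u f)
    {t : ℝ} (ht : 0 < t) :
    t ^ (((n : ℝ) - 2) / n) * decRearr n Ω u t ≤ sharpConst n * L1norm n Ω f := by
  have hn3 : (3 : ℝ) ≤ n := by exact_mod_cast hn
  have hC := sharpConst_pos hn
  have hN0 : 0 ≤ L1norm n Ω f := integral_nonneg fun x => abs_nonneg _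
  rw [← le_div_iff₀' (by positivity)]
  refine le_of_forall_gt_imp_ge_of_dense fun s hs => csInf_le ⟨0, fun _ hr => hr.1⟩ ?_
  have hs0 : 0 < s := lt_of_le_of_lt (by positivity) hs
  refine ⟨hs0.le, ?_⟩
  have h1 := h.mul_rpow_volume_le hn hΩ hb hs0
  rw [div_lt_iff₀ (by positivity)] at hs
  have h2 := lt_of_mul_lt_mul_left (h1.trans_lt hs) hs0.le
  have h3 := (Real.rpow_lt_rpow_iff measureReal_nonneg ht.le
    (div_pos (by linarith) (by linarith))).1 h2
  have hfin : volume {x ∈ Ω | s < |u x|} ≠ ∞ :=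
    ((measure_mono fun x hx => hx.1).trans_lt hb.measure_lt_top).ne
  rw [← ENNReal.ofReal_toReal hfin]
  exact ENNReal.ofReal_le_ofReal h3.le

theorem MemW21Delta0.weakNorm_le {n : ℕ} (hn : 3 ≤ n) {Ω : Set (Euc n)}
    (hΩ : IsOpen Ω) (hb : Bornology.IsBounded Ω) {u f : Euc n → ℝ} (h : MemW21Delta0 n Ω u f) :
    WeakNorm n Ω u ≤ sharpConst n * L1norm n Ω f := by
  refine Real.sSup_le ?_ (mul_nonneg (sharpConst_pos hn).le (integral_nonneg fun x => abs_nonneg _))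
  rintro _ ⟨t, ht, -, rfl⟩
  exact h.rpow_mul_decRearr_le hn hΩ hb ht

theorem MemW21Delta0.rpow_mul_decRearr_le_weakNorm {n : ℕ} (hn : 3 ≤ n) {Ω : Set (Euc n)}
    (hΩ : IsOpen Ω) (hb : Bornology.IsBounded Ω) {u f : Euc n → ℝ} (h : MemW21Delta0 n Ω u f)
    {t : ℝ} (ht : 0 < t) (htΩ : t ≤ (volume Ω).toReal) :
    t ^ (((n : ℝ) - 2) / n) * decRearr n Ω u t ≤ WeakNorm n Ω u := by
  refine le_csSup ⟨sharpConst n * L1norm n Ω f, ?_⟩ ⟨t, ht, htΩ, rfl⟩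
  rintro _ ⟨t, ht, -, rfl⟩
  exact h.rpow_mul_decRearr_le hn hΩ hb ht

/-! ### Regularized fundamental solutions -/

/-- The fundamental solution with pole `z`, regularized at scale `ε`. -/
def pole (n : ℕ) (ε : ℝ) (z x : Euc n) : ℝ := (‖x - z‖ ^ 2 + ε ^ 2) ^ (-(((n : ℝ) - 2) / 2))

theorem norm_sq_add_sq_pos {n : ℕ} {ε : ℝ} (hε : ε ≠ 0) (y : Euc n) : 0 < ‖y‖ ^ 2 + ε ^ 2 := by
  positivity

theorem pole_nonneg (n : ℕ) (ε : ℝ) (z x : Euc n) : 0 ≤ pole n ε z x :=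
  Real.rpow_nonneg (by positivity) _

theorem contDiff_pole {n : ℕ} {ε : ℝ} (hε : ε ≠ 0) (z : Euc n) {k : WithTop ℕ∞} :
    ContDiff ℝ k (pole n ε z) :=
  (((contDiff_id.sub contDiff_const).norm_sq ℝ).add contDiff_const).rpow_const_of_ne
    fun x => (norm_sq_add_sq_pos hε (x - z)).ne'

theorem hasFDerivAt_rpow_norm_sq {n : ℕ} {ε : ℝ} (hε : ε ≠ 0) (z x : Euc n) (a : ℝ) :
    HasFDerivAt (fun x => (‖x - z‖ ^ 2 + ε ^ 2) ^ a)
      ((2 * a * (‖x - z‖ ^ 2 + ε ^ 2) ^ (a - 1)) • innerSL ℝ (x - z)) x := by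
  have h := ((((hasFDerivAt_id x).sub_const z).norm_sq).add_const (ε ^ 2)).rpow_const (p := a)
    (Or.inl (norm_sq_add_sq_pos hε (x - z)).ne')
  refine h.congr_fderiv ?_
  rw [ContinuousLinearMap.comp_id, two_smul]
  ext v
  simp only [FunLike.coe_smul, Pi.smul_apply, innerSL_apply_apply, smul_eq_mul, id,
    FunLike.coe_add, Pi.add_apply]
  ring

theorem fderiv_pole {n : ℕ} {ε : ℝ} (hε : ε ≠ 0) (z x : Euc n) :
    fderiv ℝ (pole n ε z) x =
      (-((n : ℝ) - 2) * (‖x - z‖ ^ 2 + ε ^ 2) ^ (-((n : ℝ) / 2))) • innerSL ℝ (x - z) := by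
  refine (hasFDerivAt_rpow_norm_sq hε z x (-(((n : ℝ) - 2) / 2))).fderiv.trans ?_
  congr 2
  · ring
  · congr 1
    ring

theorem lapl_pole {n : ℕ} {ε : ℝ} (hε : ε ≠ 0) (z x : Euc n) :
    lapl n (pole n ε z) x =
      -(n * (n - 2) * ε ^ 2 * (‖x - z‖ ^ 2 + ε ^ 2) ^ (-((n : ℝ) / 2) - 1)) := by
  have hpos := norm_sq_add_sq_pos hε (x - z)
  have hterm : ∀ i : Fin n, fderiv ℝ (fun y => fderiv ℝ (pole n ε z) y
      (EuclideanSpace.single i 1)) x (EuclideanSpace.single i 1) =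
      -((n : ℝ) - 2) * ((‖x - z‖ ^ 2 + ε ^ 2) ^ (-((n : ℝ) / 2)) -
        n * (‖x - z‖ ^ 2 + ε ^ 2) ^ (-((n : ℝ) / 2) - 1) * (x - z) i ^ 2) := by
    intro i
    have e : (fun y => fderiv ℝ (pole n ε z) y (EuclideanSpace.single i 1)) =
        fun y => -((n : ℝ) - 2) * ((‖y - z‖ ^ 2 + ε ^ 2) ^ (-((n : ℝ) / 2)) *
          innerSL ℝ (EuclideanSpace.single i (1 : ℝ)) (y - z)) := by
      ext y
      rw [fderiv_pole hε]
      simp only [FunLike.coe_smul, Pi.smul_apply, innerSL_apply_apply, smul_eq_mul]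
      rw [real_inner_comm]
      ring
    rw [e]
    have h2 : HasFDerivAt (fun y => innerSL ℝ (EuclideanSpace.single i (1 : ℝ)) (y - z))
        (innerSL ℝ (EuclideanSpace.single i (1 : ℝ))) x :=
      ((innerSL ℝ (EuclideanSpace.single i (1 : ℝ))).hasFDerivAt).comp x
        ((hasFDerivAt_id x).sub_const z)
    rw [(((hasFDerivAt_rpow_norm_sq hε z x (-((n : ℝ) / 2))).fun_mul h2).const_mul _).fderiv]
    simp only [FunLike.coe_smul, Pi.smul_apply, innerSL_apply_apply, smul_eq_mul,
      FunLike.coe_add, Pi.add_apply, EuclideanSpace.inner_single_left, EuclideanSpace.inner_single_right]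
    simp [-mul_eq_mul_left_iff]
    ring
  rw [lapl_eq_sum_fderiv (contDiff_pole hε z), Finset.sum_congr rfl fun i _ => hterm i,
    ← Finset.mul_sum, Finset.sum_sub_distrib, ← Finset.mul_sum]
  have hs : ∑ i : Fin n, (x - z) i ^ 2 = ‖x - z‖ ^ 2 := by
    rw [EuclideanSpace.norm_sq_eq]
    simp
  have hA : (‖x - z‖ ^ 2 + ε ^ 2) ^ (-((n : ℝ) / 2)) =
      (‖x - z‖ ^ 2 + ε ^ 2) ^ (-((n : ℝ) / 2) - 1) * (‖x - z‖ ^ 2 + ε ^ 2) := by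
    rw [Real.rpow_sub_one hpos.ne', div_mul_cancel₀ _ hpos.ne']
  rw [hs, hA]
  simp only [Finset.sum_const, Finset.card_univ, Fintype.card_fin, nsmul_eq_mul]
  ring

theorem hasDerivAt_radial {n : ℕ} (hn : n ≠ 0) {ε : ℝ} (hε : ε ≠ 0) (r : ℝ) :
    HasDerivAt (fun r : ℝ => r ^ n * (r ^ 2 + ε ^ 2) ^ (-((n : ℝ) / 2)))
      (r ^ (n - 1) * (n * ε ^ 2 * (r ^ 2 + ε ^ 2) ^ (-((n : ℝ) / 2) - 1))) r := by
  have hpos : 0 < r ^ 2 + ε ^ 2 := by positivity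
  have h := (hasDerivAt_pow n r).fun_mul (((hasDerivAt_pow 2 r).add_const (ε ^ 2)).rpow_const
    (p := -((n : ℝ) / 2)) (Or.inl hpos.ne'))
  refine h.congr_deriv ?_
  have hA : (r ^ 2 + ε ^ 2) ^ (-((n : ℝ) / 2)) =
      (r ^ 2 + ε ^ 2) ^ (-((n : ℝ) / 2) - 1) * (r ^ 2 + ε ^ 2) := by
    rw [Real.rpow_sub_one hpos.ne', div_mul_cancel₀ _ hpos.ne']
  obtain ⟨k, rfl⟩ := Nat.exists_eq_succ_of_ne_zero hn
  rw [hA]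
  simp only [Nat.succ_eq_add_one, Nat.add_sub_cancel]
  push_cast
  ring

theorem tendsto_radial {n : ℕ} {ε : ℝ} (hε : ε ≠ 0) :
    Tendsto (fun r : ℝ => r ^ n * (r ^ 2 + ε ^ 2) ^ (-((n : ℝ) / 2))) atTop (𝓝 1) := by
  have h1 : Tendsto (fun r : ℝ => r ^ 2 + ε ^ 2) atTop atTop :=
    tendsto_atTop_add_const_right _ _ (tendsto_pow_atTop two_ne_zero)
  have h2 : Tendsto (fun r : ℝ => (1 - ε ^ 2 / (r ^ 2 + ε ^ 2)) ^ ((n : ℝ) / 2)) atTop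
      (𝓝 ((1 - 0) ^ ((n : ℝ) / 2))) :=
    (tendsto_const_nhds.sub (h1.const_div_atTop _)).rpow_const (Or.inl (by norm_num))
  rw [sub_zero, Real.one_rpow] at h2
  refine h2.congr' ?_
  filter_upwards [eventually_ge_atTop 0] with r hr
  have hpos : 0 < r ^ 2 + ε ^ 2 := by positivity
  have e : 1 - ε ^ 2 / (r ^ 2 + ε ^ 2) = r ^ 2 / (r ^ 2 + ε ^ 2) := by
    field_simp
    ring
  have e2 : (r ^ 2) ^ ((n : ℝ) / 2) = r ^ n := by
    rw [← Real.rpow_natCast r 2, ← Real.rpow_mul hr, ← Real.rpow_natCast r n]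
    congr 1
    push_cast
    ring
  rw [e, Real.div_rpow (by positivity) hpos.le, e2, Real.rpow_neg hpos.le, div_eq_mul_inv]

theorem integrable_and_integral_lapl_pole {n : ℕ} (hn : 2 ≤ n) {ε : ℝ} (hε : ε ≠ 0) (z : Euc n) :
    Integrable (fun x => |lapl n (pole n ε z) x|) ∧
      ∫ x, |lapl n (pole n ε z) x| = n * (n - 2) * (omegaS n / n) := by
  have hn0 : n ≠ 0 := by omega
  have hn2 : (2 : ℝ) ≤ n := by exact_mod_cast hn
  have : Nonempty (Fin n) := ⟨⟨0, by omega⟩⟩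
  set h : ℝ → ℝ := fun r => n * ε ^ 2 * (r ^ 2 + ε ^ 2) ^ (-((n : ℝ) / 2) - 1)
  have hh : ∀ r, 0 ≤ h r := fun r => by positivity
  have e : ∀ x, |lapl n (pole n ε z) x| = ((n : ℝ) - 2) * h ‖x - z‖ := fun x => by
    rw [lapl_pole hε, abs_neg, abs_of_nonneg]
    · simp only [h]
      ring
    · have : (0 : ℝ) ≤ n - 2 := by linarith
      positivity
  have hd := fun r (_ : r ∈ Set.Ici (0 : ℝ)) => hasDerivAt_radial hn0 hε r
  have h0 : ∀ r ∈ Set.Ioi (0 : ℝ), 0 ≤ r ^ (n - 1) * h r := fun r hr =>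
    mul_nonneg (pow_nonneg (le_of_lt hr) _) (hh r)
  have hI : Integrable fun x : Euc n => h ‖x‖ := by
    rw [integrable_fun_norm_addHaar, finrank_euclideanSpace_fin]
    exact integrableOn_Ioi_deriv_of_nonneg' hd h0 (tendsto_radial hε)
  have hv : ∫ x : Euc n, h ‖x‖ = omegaS n := by
    have hi := integral_Ioi_of_hasDerivAt_of_nonneg' hd h0 (tendsto_radial hε)
    simp only [zero_pow hn0, zero_mul, sub_zero] at hi
    rw [integral_fun_norm_addHaar, finrank_euclideanSpace_fin,
      volume_real_ball hn0 _ zero_le_one]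
    simp only [smul_eq_mul, nsmul_eq_mul, one_pow, mul_one]
    rw [hi]
    field_simp
  simp_rw [e]
  refine ⟨(hI.comp_sub_right z).const_mul _, ?_⟩
  rw [integral_const_mul, integral_sub_right_eq_self (fun x : Euc n => h ‖x‖), hv]
  field_simp

/-! ### The Laplacian of a product -/

theorem lapl_sub {n : ℕ} {u v : Euc n → ℝ} (hu : ContDiff ℝ 2 u) (hv : ContDiff ℝ 2 v)
    (x : Euc n) : lapl n (fun y => u y - v y) x = lapl n u x - lapl n v x := by
  have := iteratedFDeriv_sub_apply (𝕜 := ℝ) (x := x) (i := 2) hu.contDiffAt hv.contDiffAt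
  simp only [lapl, ← Finset.sum_sub_distrib]
  refine Finset.sum_congr rfl fun i _ => ?_
  exact DFunLike.congr_fun this _

theorem lapl_mul {n : ℕ} {u v : Euc n → ℝ} (hu : ContDiff ℝ 2 u) (hv : ContDiff ℝ 2 v)
    (x : Euc n) : lapl n (fun y => u y * v y) x = u x * lapl n v x + v x * lapl n u x +
      2 * ∑ i : Fin n, fderiv ℝ u x (EuclideanSpace.single i 1) *
        fderiv ℝ v x (EuclideanSpace.single i 1) := by
  have hdu := hu.differentiable two_ne_zero
  have hdv := hv.differentiable two_ne_zero
  rw [lapl_eq_sum_fderiv (hu.mul hv), lapl_eq_sum_fderiv hu, lapl_eq_sum_fderiv hv,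
    Finset.mul_sum, Finset.mul_sum, Finset.mul_sum, ← Finset.sum_add_distrib,
    ← Finset.sum_add_distrib]
  refine Finset.sum_congr rfl fun i _ => ?_
  set w : Euc n := EuclideanSpace.single i 1
  have hu1 := (contDiff_fderiv_apply hu w).differentiable one_ne_zero x
  have hv1 := (contDiff_fderiv_apply hv w).differentiable one_ne_zero x
  have e : (fun y => fderiv ℝ (fun y => u y * v y) y w) =
      fun y => u y * fderiv ℝ v y w + v y * fderiv ℝ u y w := by
    ext y
    rw [fderiv_fun_mul (hdu y) (hdv y)]
    simp
  rw [e, fderiv_fun_add ((hdu x).fun_mul hv1) ((hdv x).fun_mul hu1), fderiv_fun_mul (hdu x) hv1,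
    fderiv_fun_mul (hdv x) hu1]
  simp only [FunLike.coe_smul, Pi.smul_apply, smul_eq_mul, FunLike.coe_add, Pi.add_apply]
  ring

theorem abs_sum_mul_apply_single_le {n : ℕ} (l m : Euc n →L[ℝ] ℝ) :
    |∑ i : Fin n, l (EuclideanSpace.single i 1) * m (EuclideanSpace.single i 1)| ≤
      ‖l‖ * ‖m‖ := by
  refine abs_le_of_sq_le_sq ?_ (by positivity)
  rw [mul_pow, ← sum_sq_apply_single, ← sum_sq_apply_single]
  exact Finset.sum_mul_sq_le_sq_mul_sq _ _ _

theorem abs_lapl_mul_le {n : ℕ} {u v : Euc n → ℝ} (hu : ContDiff ℝ 2 u) (hv : ContDiff ℝ 2 v)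
    {x : Euc n} (h0 : 0 ≤ u x) (h1 : u x ≤ 1) :
    |lapl n (fun y => u y * v y) x| ≤ |lapl n v x| +
      (|lapl n u x| * |v x| + 2 * ‖fderiv ℝ u x‖ * ‖fderiv ℝ v x‖) := by
  rw [lapl_mul hu hv]
  have e1 : |u x * lapl n v x| ≤ |lapl n v x| := by
    rw [abs_mul, abs_of_nonneg h0]
    exact mul_le_of_le_one_left (abs_nonneg _) h1
  have e2 : |v x * lapl n u x| = |lapl n u x| * |v x| := by rw [abs_mul, mul_comm]
  have e3 := abs_sum_mul_apply_single_le (fderiv ℝ u x) (fderiv ℝ v x)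
  set σ := ∑ i : Fin n, fderiv ℝ u x (EuclideanSpace.single i 1) *
        fderiv ℝ v x (EuclideanSpace.single i 1)
  have e4 : |2 * σ| ≤ 2 * ‖fderiv ℝ u x‖ * ‖fderiv ℝ v x‖ := by
    rw [abs_mul, abs_two, mul_assoc]
    linarith
  have := abs_add_le (u x * lapl n v x + v x * lapl n u x) (2 * σ)
  have := abs_add_le (u x * lapl n v x) (v x * lapl n u x)
  linarith

/-! ### Truncated dipoles and sharpness -/

theorem IsTestFun.memW21Delta0 {n : ℕ} {Ω : Set (Euc n)} {u : Euc n → ℝ} (h : IsTestFun n Ω u) :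
    MemW21Delta0 n Ω u (lapl n u) :=
  ⟨(h.1.continuous.integrable_of_hasCompactSupport h.2.1).integrableOn,
    (integrable_lapl h.contDiff_two h.2.1).integrableOn, fun _ => u, fun _ => h, by simp, by simp⟩

/-- The difference of two regularized fundamental solutions with poles `z ± d e`. -/
def dipole (n : ℕ) (z e : Euc n) (d : ℝ) (x : Euc n) : ℝ :=
  pole n (d ^ 3) (z + d • e) x - pole n (d ^ 3) (z - d • e) x

theorem contDiff_dipole {n : ℕ} (z e : Euc n) {d : ℝ} (hd : d ≠ 0) {k : WithTop ℕ∞} :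
    ContDiff ℝ k (dipole n z e d) :=
  (contDiff_pole (pow_ne_zero 3 hd) _).sub (contDiff_pole (pow_ne_zero 3 hd) _)

theorem abs_lapl_dipole_le {n : ℕ} (z e : Euc n) {d : ℝ} (hd : d ≠ 0) (x : Euc n) :
    |lapl n (dipole n z e d) x| ≤
      |lapl n (pole n (d ^ 3) (z + d • e)) x| + |lapl n (pole n (d ^ 3) (z - d • e)) x| := by
  have h := lapl_sub (contDiff_pole (n := n) (pow_ne_zero 3 hd) (z + d • e))
    (contDiff_pole (n := n) (pow_ne_zero 3 hd) (z - d • e)) x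
  exact (congrArg abs h).trans_le (abs_sub _ _)

theorem fderiv_dipole {n : ℕ} (z e : Euc n) {d : ℝ} (hd : d ≠ 0) (x : Euc n) :
    fderiv ℝ (dipole n z e d) x =
      (-((n : ℝ) - 2) * (‖x - (z + d • e)‖ ^ 2 + (d ^ 3) ^ 2) ^ (-((n : ℝ) / 2))) •
        innerSL ℝ (x - (z + d • e)) -
      (-((n : ℝ) - 2) * (‖x - (z - d • e)‖ ^ 2 + (d ^ 3) ^ 2) ^ (-((n : ℝ) / 2))) •
        innerSL ℝ (x - (z - d • e)) := by
  rw [← fderiv_pole (pow_ne_zero 3 hd), ← fderiv_pole (pow_ne_zero 3 hd)]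
  exact fderiv_sub ((contDiff_pole (pow_ne_zero 3 hd) _ (k := 1)).differentiable one_ne_zero x)
    ((contDiff_pole (pow_ne_zero 3 hd) _ (k := 1)).differentiable one_ne_zero x)

theorem continuousAt_rpow_pole {n : ℕ} {x z : Euc n} (hx : x ≠ z) (e : Euc n) (a : ℝ) :
    ContinuousAt (fun d : ℝ => (‖x - (z + d • e)‖ ^ 2 + (d ^ 3) ^ 2) ^ a) 0 := by
  refine ContinuousAt.rpow_const (by fun_prop) (Or.inl ?_)
  have : 0 < ‖x - z‖ := norm_pos_iff.2 (sub_ne_zero.2 hx)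
  simp only [zero_smul, add_zero]
  positivity

theorem tendsto_dipole {n : ℕ} {x z : Euc n} (hx : x ≠ z) (e : Euc n) :
    Tendsto (fun d => dipole n z e d x) (𝓝[>] 0) (𝓝 0) := by
  have h1 := continuousAt_rpow_pole hx e (-(((n : ℝ) - 2) / 2))
  have h2 := continuousAt_rpow_pole hx (-e) (-(((n : ℝ) - 2) / 2))
  have h := (h1.fun_sub h2).tendsto
  simp only [smul_neg, ← sub_eq_add_neg, zero_smul, add_zero, sub_zero, sub_self] at h
  exact tendsto_nhdsWithin_of_tendsto_nhds h

theorem tendsto_fderiv_dipole {n : ℕ} {x z : Euc n} (hx : x ≠ z) (e : Euc n) :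
    Tendsto (fun d => ‖fderiv ℝ (dipole n z e d) x‖) (𝓝[>] 0) (𝓝 0) := by
  have h0 : ∀ e : Euc n, ContinuousAt (fun d : ℝ => (-((n : ℝ) - 2) *
      (‖x - (z + d • e)‖ ^ 2 + (d ^ 3) ^ 2) ^ (-((n : ℝ) / 2))) • innerSL ℝ (x - (z + d • e))) 0 :=
    fun e => (continuousAt_const.mul (continuousAt_rpow_pole hx e _)).smul
      ((innerSL ℝ).continuous.comp (by fun_prop : Continuous fun d : ℝ =>
        x - (z + d • e))).continuousAt
  have h := ((h0 e).fun_sub (h0 (-e))).norm.tendsto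
  simp only [smul_neg, ← sub_eq_add_neg, zero_smul, add_zero, sub_zero, sub_self, norm_zero] at h
  refine (tendsto_nhdsWithin_of_tendsto_nhds h).congr' ?_
  filter_upwards [self_mem_nhdsWithin] with d hd
  rw [fderiv_dipole z e (ne_of_gt hd)]

theorem half_le_norm_sub_pole {n : ℕ} {x z e : Euc n} (he : ‖e‖ = 1) {r d : ℝ} (hd : 0 < d)
    (hdr : d ≤ r / 2) (hx : r ≤ ‖x - z‖) :
    r / 2 ≤ ‖x - (z + d • e)‖ ∧ r / 2 ≤ ‖x - (z - d • e)‖ := by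
  have hde : ‖d • e‖ = d := by rw [norm_smul, he, mul_one, Real.norm_of_nonneg hd.le]
  have h1 := norm_sub_norm_le (x - z) (d • e)
  have h2 := norm_sub_le (x - z + d • e) (d • e)
  rw [sub_sub] at h1
  rw [add_sub_cancel_right] at h2
  have e3 : x - (z - d • e) = x - z + d • e := by abel
  rw [e3]
  constructor <;> linarith

theorem abs_dipole_le {n : ℕ} (hn : 2 ≤ n) {x z e : Euc n} (he : ‖e‖ = 1) {r d : ℝ} (hd : 0 < d)
    (hdr : d ≤ r / 2) (hx : r ≤ ‖x - z‖) :
    |dipole n z e d x| ≤ 2 * ((r / 2) ^ 2) ^ (-(((n : ℝ) - 2) / 2)) := by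
  have hn2 : (2 : ℝ) ≤ n := by exact_mod_cast hn
  have key : ∀ y : Euc n, r / 2 ≤ ‖x - y‖ →
      pole n (d ^ 3) y x ≤ ((r / 2) ^ 2) ^ (-(((n : ℝ) - 2) / 2)) := by
    intro y hy
    have hr : 0 < r / 2 := hd.trans_le hdr
    exact Real.rpow_le_rpow_of_nonpos (by positivity)
      (by nlinarith [sq_nonneg (d ^ 3)]) (by linarith)
  obtain ⟨h1, h2⟩ := half_le_norm_sub_pole he hd hdr hx
  have := key _ h1
  have := key _ h2
  have := pole_nonneg n (d ^ 3) (z + d • e) x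
  have := pole_nonneg n (d ^ 3) (z - d • e) x
  rw [dipole, abs_le]
  constructor <;> linarith

theorem norm_fderiv_dipole_le {n : ℕ} (hn : 2 ≤ n) {x z e : Euc n} (he : ‖e‖ = 1) {r d : ℝ}
    (hd : 0 < d) (hdr : d ≤ r / 2) (hx : r ≤ ‖x - z‖) (hx2 : ‖x - z‖ ≤ 2 * r) :
    ‖fderiv ℝ (dipole n z e d) x‖ ≤
      2 * ((n - 2) * ((r / 2) ^ 2) ^ (-((n : ℝ) / 2)) * (3 * r)) := by
  have hn2 : (0 : ℝ) ≤ n - 2 := by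
    have : (2 : ℝ) ≤ n := by exact_mod_cast hn
    linarith
  have hr : 0 < r / 2 := hd.trans_le hdr
  have hde : ‖d • e‖ = d := by rw [norm_smul, he, mul_one, Real.norm_of_nonneg hd.le]
  have key : ∀ y : Euc n, r / 2 ≤ ‖x - y‖ → ‖x - y‖ ≤ 3 * r →
      ‖(-((n : ℝ) - 2) * (‖x - y‖ ^ 2 + (d ^ 3) ^ 2) ^ (-((n : ℝ) / 2))) • innerSL ℝ (x - y)‖ ≤
        (n - 2) * ((r / 2) ^ 2) ^ (-((n : ℝ) / 2)) * (3 * r) := by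
    intro y hy hy2
    have h : (‖x - y‖ ^ 2 + (d ^ 3) ^ 2) ^ (-((n : ℝ) / 2)) ≤ ((r / 2) ^ 2) ^ (-((n : ℝ) / 2)) :=
      Real.rpow_le_rpow_of_nonpos (by positivity) (by nlinarith [sq_nonneg (d ^ 3)])
        (by linarith)
    rw [norm_smul, innerSL_apply_norm, norm_mul, norm_neg, Real.norm_of_nonneg hn2,
      Real.norm_of_nonneg (by positivity)]
    gcongr
  obtain ⟨h1, h2⟩ := half_le_norm_sub_pole he hd hdr hx
  have h3 := norm_sub_le (x - z) (d • e)
  have h4 := norm_add_le (x - z) (d • e)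
  rw [sub_sub] at h3
  rw [show x - z + d • e = x - (z - d • e) by abel] at h4
  rw [fderiv_dipole z e hd.ne']
  refine (norm_sub_le _ _).trans ?_
  have := key _ h1 (by linarith)
  have := key _ h2 (by linarith)
  linarith

/-- The error term of the truncated dipole. -/
theorem tendsto_integral_cutoff_error {n : ℕ} (hn : 2 ≤ n) {z e : Euc n} (he : ‖e‖ = 1)
    (χ : ContDiffBump z) (hχ : χ.rOut = 2 * χ.rIn) :
    Tendsto (fun d => ∫ x, (|lapl n χ x| * |dipole n z e d x| +
      2 * ‖fderiv ℝ χ x‖ * ‖fderiv ℝ (dipole n z e d) x‖)) (𝓝[>] 0) (𝓝 0) := by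
  set r := χ.rIn
  have hr : 0 < r := χ.rIn_pos
  have hχ2 : ContDiff ℝ 2 χ := χ.contDiff (n := 2)
  have hcl : Continuous (lapl n χ) := continuous_lapl hχ2
  have hcd : Continuous (fderiv ℝ χ) := hχ2.continuous_fderiv two_ne_zero
  have hsl : HasCompactSupport (lapl n χ) := χ.hasCompactSupport.lapl
  have hsd : HasCompactSupport (fderiv ℝ χ) := χ.hasCompactSupport.fderiv ℝ
  have hz : ∀ x, ¬ (r ≤ ‖x - z‖ ∧ ‖x - z‖ ≤ 2 * r) → lapl n χ x = 0 ∧ fderiv ℝ χ x = 0 := by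
    intro x hx
    rcases lt_or_ge ‖x - z‖ r with h1 | h1
    · have hev : (χ : Euc n → ℝ) =ᶠ[𝓝 x] fun _ => 1 := by
        filter_upwards [Metric.isOpen_ball.mem_nhds (mem_ball_iff_norm.2 h1)] with y hy
        exact χ.one_of_mem_closedBall (Metric.ball_subset_closedBall hy)
      refine ⟨?_, ?_⟩
      · rw [lapl, (EventuallyEq.iteratedFDeriv ℝ hev 2).eq_of_nhds]
        simp [iteratedFDeriv_const_of_ne two_ne_zero]
      · rw [hev.fderiv_eq]
        simp
    · have h2 : x ∉ tsupport χ := by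
        rw [χ.tsupport_eq, mem_closedBall_iff_norm, hχ]
        exact fun h => hx ⟨h1, h⟩
      refine ⟨?_, ?_⟩
      · by_contra h
        exact h2 (tsupport_lapl_subset _ (subset_tsupport _ h))
      · by_contra h
        exact h2 (tsupport_fderiv_subset ℝ (subset_tsupport _ h))
  set A := 2 * ((r / 2) ^ 2) ^ (-(((n : ℝ) - 2) / 2))
  set B := 2 * ((n - 2) * ((r / 2) ^ 2) ^ (-((n : ℝ) / 2)) * (3 * r))
  have hlim := tendsto_integral_filter_of_dominated_convergence (μ := volume) (l := 𝓝[>] (0 : ℝ))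
    (F := fun d x => |lapl n χ x| * |dipole n z e d x| +
      2 * ‖fderiv ℝ χ x‖ * ‖fderiv ℝ (dipole n z e d) x‖) (f := fun _ => (0 : ℝ))
    (fun x => |lapl n χ x| * A + 2 * ‖fderiv ℝ χ x‖ * B) ?_ ?_ ?_ ?_
  · simpa using hlim
  · filter_upwards [self_mem_nhdsWithin] with d hd
    have h2 : ContDiff ℝ 2 (dipole n z e d) := contDiff_dipole z e (ne_of_gt hd)
    exact ((hcl.abs.mul h2.continuous.abs).add
      ((continuous_const.mul hcd.norm).mul
        (h2.continuous_fderiv two_ne_zero).norm)).aestronglyMeasurable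
  · filter_upwards [Ioc_mem_nhdsGT (half_pos hr)] with d hd
    refine Eventually.of_forall fun x => ?_
    rw [Real.norm_of_nonneg (by positivity)]
    by_cases hx : r ≤ ‖x - z‖ ∧ ‖x - z‖ ≤ 2 * r
    · have := abs_dipole_le hn he hd.1 hd.2 hx.1
      have := norm_fderiv_dipole_le hn he hd.1 hd.2 hx.1 hx.2
      gcongr
    · simp [hz x hx]
  · exact ((hcl.abs.integrable_of_hasCompactSupport hsl.norm).mul_const _).add
      (((hcd.norm.integrable_of_hasCompactSupport hsd.norm).const_mul _).mul_const _)
  · refine Eventually.of_forall fun x => ?_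
    by_cases hx : r ≤ ‖x - z‖ ∧ ‖x - z‖ ≤ 2 * r
    · have hxz : x ≠ z := by
        rintro rfl
        rw [sub_self, norm_zero] at hx
        linarith [hx.1]
      have h := ((tendsto_dipole hxz e).abs.const_mul |lapl n χ x|).add
        ((tendsto_fderiv_dipole hxz e).const_mul (2 * ‖fderiv ℝ χ x‖))
      simpa using h
    · simp [hz x hx]

theorem integral_abs_lapl_truncated_dipole_le {n : ℕ} (hn : 2 ≤ n) {z e : Euc n}
    (χ : ContDiffBump z) {d : ℝ} (hd : d ≠ 0) :
    ∫ x, |lapl n (fun y => χ y * dipole n z e d y) x| ≤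
      2 * (n * (n - 2) * (omegaS n / n)) + ∫ x, (|lapl n χ x| * |dipole n z e d x| +
      2 * ‖fderiv ℝ χ x‖ * ‖fderiv ℝ (dipole n z e d) x‖) := by
  have hχ2 : ContDiff ℝ 2 χ := χ.contDiff (n := 2)
  have hD : ContDiff ℝ 2 (dipole n z e d) := contDiff_dipole z e hd
  obtain ⟨i1, v1⟩ := integrable_and_integral_lapl_pole hn (pow_ne_zero 3 hd) (z + d • e)
  obtain ⟨i2, v2⟩ := integrable_and_integral_lapl_pole hn (pow_ne_zero 3 hd) (z - d • e)
  have i3 : Integrable fun x => |lapl n χ x| * |dipole n z e d x| +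
      2 * ‖fderiv ℝ χ x‖ * ‖fderiv ℝ (dipole n z e d) x‖ := by
    refine Integrable.add ?_ ?_
    · exact ((continuous_lapl hχ2).abs.mul hD.continuous.abs).integrable_of_hasCompactSupport
        χ.hasCompactSupport.lapl.norm.mul_right
    · exact ((continuous_const.mul (hχ2.continuous_fderiv two_ne_zero).norm).mul
        (hD.continuous_fderiv two_ne_zero).norm).integrable_of_hasCompactSupport
        (χ.hasCompactSupport.fderiv ℝ).norm.mul_left.mul_right
  have i12 : Integrable fun x => |lapl n (pole n (d ^ 3) (z + d • e)) x| +
    |lapl n (pole n (d ^ 3) (z - d • e)) x| := i1.add i2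
  rw [two_mul, ← v1]
  nth_rw 2 [v1]
  rw [← v2, ← integral_add i1 i2, ← integral_add i12 i3]
  refine integral_mono ((integrable_lapl (hχ2.mul hD) χ.hasCompactSupport.mul_right).abs)
    (i12.add i3) fun x => ?_
  refine (abs_lapl_mul_le hχ2 hD χ.nonneg χ.le_one).trans ?_
  exact add_le_add_left (abs_lapl_dipole_le z e hd x) _

/-- The height of a truncated dipole near its poles. -/
def dipoleLevel (n : ℕ) (d : ℝ) : ℝ :=
  ((d ^ 2) ^ 2 + (d ^ 3) ^ 2) ^ (-(((n : ℝ) - 2) / 2)) -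
    (d ^ 2 + (d ^ 3) ^ 2) ^ (-(((n : ℝ) - 2) / 2))

theorem dipoleLevel_lt_dipole {n : ℕ} (hn : 3 ≤ n) {x z e : Euc n} (he : ‖e‖ = 1) {d : ℝ}
    (hd : 0 < d) (hd1 : d < 1) (hx : ‖x - (z + d • e)‖ < d ^ 2) :
    dipoleLevel n d < dipole n z e d x := by
  have hn3 : (3 : ℝ) ≤ n := by exact_mod_cast hn
  have h1 : ‖(2 * d) • e‖ = 2 * d := by
    rw [norm_smul, he, mul_one, Real.norm_of_nonneg (by linarith)]
  have h2 : (2 * d) • e = (x - (z - d • e)) - (x - (z + d • e)) := by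
    rw [two_mul, add_smul]
    abel
  have h3 := norm_sub_le (x - (z - d • e)) (x - (z + d • e))
  rw [← h2, h1] at h3
  have h4 : d ≤ ‖x - (z - d • e)‖ := by nlinarith
  have hnear : ((d ^ 2) ^ 2 + (d ^ 3) ^ 2) ^ (-(((n : ℝ) - 2) / 2)) <
      pole n (d ^ 3) (z + d • e) x :=
    Real.rpow_lt_rpow_of_neg (by positivity) (by gcongr) (by linarith)
  have hfar : pole n (d ^ 3) (z - d • e) x ≤
      (d ^ 2 + (d ^ 3) ^ 2) ^ (-(((n : ℝ) - 2) / 2)) :=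
    Real.rpow_le_rpow_of_nonpos (by positivity) (by gcongr) (by linarith)
  unfold dipoleLevel dipole
  linarith

theorem dipole_neg (n : ℕ) (z e : Euc n) (d : ℝ) (x : Euc n) :
    dipole n z (-e) d x = -dipole n z e d x := by
  simp [dipole, ← sub_eq_add_neg]

theorem le_volume_truncated_dipole {n : ℕ} (hn : 3 ≤ n) {Ω : Set (Euc n)} {z e : Euc n}
    (he : ‖e‖ = 1) (χ : ContDiffBump z) (hΩ : Metric.closedBall z χ.rIn ⊆ Ω) {d : ℝ}
    (hd : 0 < d) (hd1 : d < 1) (hdr : d ≤ χ.rIn / 2) :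
    ENNReal.ofReal (2 * (omegaS n / n) * (d ^ 2) ^ n) ≤
      volume {x ∈ Ω | dipoleLevel n d < |χ x * dipole n z e d x|} := by
  have hω := omegaS_pos (n := n) (by omega)
  have key : ∀ e : Euc n, ‖e‖ = 1 → ∀ x ∈ Metric.ball (z + d • e) (d ^ 2),
      x ∈ Ω ∧ χ x = 1 ∧ dipoleLevel n d < dipole n z e d x := by
    intro e he x hx
    rw [mem_ball_iff_norm] at hx
    have hde : ‖d • e‖ = d := by rw [norm_smul, he, mul_one, Real.norm_of_nonneg hd.le]
    have h1 := norm_add_le (x - (z + d • e)) (d • e)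
    rw [show x - (z + d • e) + d • e = x - z by abel, hde] at h1
    have h2 : x ∈ Metric.closedBall z χ.rIn := by
      rw [mem_closedBall_iff_norm]
      nlinarith
    exact ⟨hΩ h2, χ.one_of_mem_closedBall h2, dipoleLevel_lt_dipole hn he hd hd1 hx⟩
  have hdisj : Disjoint (Metric.ball (z + d • e) (d ^ 2)) (Metric.ball (z + d • -e) (d ^ 2)) := by
    refine Metric.ball_disjoint_ball ?_
    rw [dist_eq_norm, show z + d • e - (z + d • -e) = (2 * d) • e by
      rw [two_mul, add_smul, smul_neg]; abel, norm_smul, he, mul_one,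
      Real.norm_of_nonneg (by linarith)]
    nlinarith
  have hvol : volume (Metric.ball (z + d • e) (d ^ 2) ∪ Metric.ball (z + d • -e) (d ^ 2)) =
      ENNReal.ofReal (2 * (omegaS n / n) * (d ^ 2) ^ n) := by
    rw [measure_union hdisj measurableSet_ball, volume_ball_eq_ofReal (by omega) _ (by positivity),
      volume_ball_eq_ofReal (by omega) _ (by positivity),
      ← ENNReal.ofReal_add (by positivity) (by positivity)]
    congr 1
    ring
  rw [← hvol]
  refine measure_mono (Set.union_subset (fun x hx => ?_) fun x hx => ?_)
  · obtain ⟨h1, h2, h3⟩ := key e he x hx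
    refine ⟨h1, ?_⟩
    rw [h2, one_mul]
    exact h3.trans_le (le_abs_self _)
  · obtain ⟨h1, h2, h3⟩ := key (-e) (by rwa [norm_neg]) x hx
    refine ⟨h1, ?_⟩
    rw [h2, one_mul]
    rw [dipole_neg] at h3
    exact h3.trans_le (neg_le_abs _)

theorem le_decRearr {n : ℕ} {Ω : Set (Euc n)} {u : Euc n → ℝ} (hu : Continuous u)
    (hc : HasCompactSupport u) {s t V : ℝ} (hV : ENNReal.ofReal V ≤ volume {x ∈ Ω | s < |u x|})
    (ht0 : 0 ≤ t) (ht : t < V) : s ≤ decRearr n Ω u t := by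
  obtain ⟨C, hC⟩ := hu.bounded_above_of_compact_support hc
  refine le_csInf ⟨max C 0, le_max_right _ _, ?_⟩ fun s' hs' => ?_
  · have : {x ∈ Ω | max C 0 < |u x|} = ∅ := by
      ext x
      simp only [Set.mem_ofPred_eq, Set.mem_empty_iff_false, iff_false, not_and, not_lt]
      exact fun _ => (hC x).trans (le_max_left _ _)
    rw [this, measure_empty]
    exact zero_le
  · by_contra! h
    have hsub : {x ∈ Ω | s < |u x|} ⊆ {x ∈ Ω | s' < |u x|} := fun x hx => ⟨hx.1, h.trans hx.2⟩
    have h1 : ENNReal.ofReal V ≤ ENNReal.ofReal t := (hV.trans (measure_mono hsub)).trans hs'.2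
    exact absurd ((ENNReal.ofReal_le_ofReal_iff ht0).1 h1) (not_le.2 ht)

theorem rpow_mul_dipoleLevel {n : ℕ} (hn : 3 ≤ n) {κ d : ℝ} (hκ : 0 < κ) (hd : 0 < d)
    (hd1 : d < 1) :
    (2 * κ * (d ^ 2) ^ n * (1 - d)) ^ (((n : ℝ) - 2) / n) * dipoleLevel n d =
      (2 * κ) ^ (((n : ℝ) - 2) / n) * (1 - d) ^ (((n : ℝ) - 2) / n) *
        ((1 + d ^ 2) ^ (-(((n : ℝ) - 2) / 2)) -
          (d ^ 2) ^ (((n : ℝ) - 2) / 2) * (1 + d ^ 4) ^ (-(((n : ℝ) - 2) / 2))) := by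
  have hn3 : (3 : ℝ) ≤ n := by exact_mod_cast hn
  have h1d : 0 < 1 - d := by linarith
  set β := ((n : ℝ) - 2) / 2 with hβ
  have e1 : ((d ^ 2) ^ n) ^ (((n : ℝ) - 2) / n) = (d ^ 2) ^ β * (d ^ 2) ^ β := by
    rw [← Real.rpow_natCast, ← Real.rpow_mul (by positivity), ← Real.rpow_add (by positivity)]
    congr 1
    rw [hβ]
    field_simp
    ring
  have e2 : ((d ^ 2) ^ 2 + (d ^ 3) ^ 2) ^ (-β) =
      (d ^ 2) ^ (-β) * (d ^ 2) ^ (-β) * (1 + d ^ 2) ^ (-β) := by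
    rw [← Real.mul_rpow (by positivity) (by positivity),
      ← Real.mul_rpow (by positivity) (by positivity)]
    congr 1
    ring
  have e3 : (d ^ 2 + (d ^ 3) ^ 2) ^ (-β) = (d ^ 2) ^ (-β) * (1 + d ^ 4) ^ (-β) := by
    rw [← Real.mul_rpow (by positivity) (by positivity)]
    congr 1
    ring
  have e4 : (d ^ 2) ^ (-β) = ((d ^ 2) ^ β)⁻¹ := Real.rpow_neg (by positivity) _
  have hb : (d ^ 2) ^ β ≠ 0 := (Real.rpow_pos_of_pos (by positivity) _).ne'
  rw [Real.mul_rpow (by positivity) h1d.le, Real.mul_rpow (by positivity) (by positivity), e1,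
    dipoleLevel, ← hβ, e2, e3, e4]
  generalize (d ^ 2) ^ β = b at hb
  field_simp

theorem sharpConst_le {n : ℕ} (hn : 3 ≤ n) {Ω : Set (Euc n)} (hΩ : IsOpen Ω)
    (hb : Bornology.IsBounded Ω) (hne : Ω.Nonempty) {c : ℝ}
    (hc : ∀ u f : Euc n → ℝ, MemW21Delta0 n Ω u f → WeakNorm n Ω u ≤ c * L1norm n Ω f) :
    sharpConst n ≤ c := by
  have hn3 : (3 : ℝ) ≤ n := by exact_mod_cast hn
  have hn2 : (0 : ℝ) < n - 2 := by linarith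
  have hω := omegaS_pos (n := n) (by omega)
  set κ := omegaS n / n
  have hκ : 0 < κ := div_pos hω (by linarith)
  obtain ⟨z, hz⟩ := hne
  obtain ⟨R, hR, hRΩ⟩ := Metric.nhds_basis_closedBall.mem_iff.1 (hΩ.mem_nhds hz)
  set χ : ContDiffBump z := ⟨R / 2, R, half_pos hR, half_lt_self hR⟩
  set e : Euc n := EuclideanSpace.single ⟨0, by omega⟩ 1
  have he : ‖e‖ = 1 := by simp [e]
  set E : ℝ → ℝ := fun d => ∫ x, (|lapl n χ x| * |dipole n z e d x| +
      2 * ‖fderiv ℝ χ x‖ * ‖fderiv ℝ (dipole n z e d) x‖)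
  have hE : Tendsto E (𝓝[>] 0) (𝓝 0) :=
    tendsto_integral_cutoff_error (by omega) he χ (by simp only [χ]; ring)
  set p := ((n : ℝ) - 2) / n with hp
  have hp0 : 0 < p := by positivity
  set β := ((n : ℝ) - 2) / 2 with hβ
  have hβ0 : 0 < β := by positivity
  have hev : ∀ᶠ d in 𝓝[>] (0 : ℝ), (2 * κ) ^ p * (1 - d) ^ p *
      ((1 + d ^ 2) ^ (-β) - (d ^ 2) ^ β * (1 + d ^ 4) ^ (-β)) ≤
      max c 0 * (2 * (n * (n - 2) * κ) + E d) := by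
    filter_upwards [Ioo_mem_nhdsGT one_pos, Ioc_mem_nhdsGT (half_pos (half_pos hR))] with d hd hdr
    have hd0 : 0 < d := hd.1
    have h1d : 0 < 1 - d := by linarith [hd.2]
    set u : Euc n → ℝ := fun x => χ x * dipole n z e d x
    have hu : IsTestFun n Ω u :=
      ⟨χ.contDiff.mul (contDiff_dipole z e hd0.ne'), χ.hasCompactSupport.mul_right,
        (tsupport_mul_subset_left).trans (χ.tsupport_eq.trans_subset hRΩ)⟩
    have hM := hu.memW21Delta0
    have hV := le_volume_truncated_dipole hn he χ (Ω := Ω)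
      ((Metric.closedBall_subset_closedBall (half_le_self hR.le)).trans hRΩ) hd0 hd.2 hdr.2
    set t := 2 * κ * (d ^ 2) ^ n * (1 - d)
    have ht0 : 0 < t := by positivity
    have htV : t < 2 * κ * (d ^ 2) ^ n := mul_lt_of_lt_one_right (by positivity) (by linarith)
    have htΩ : t ≤ (volume Ω).toReal := by
      have h1 := hV.trans (measure_mono (t := Ω) fun x hx => hx.1)
      have h2 := ENNReal.toReal_mono hb.measure_lt_top.ne h1
      rw [ENNReal.toReal_ofReal (by positivity)] at h2
      exact htV.le.trans h2
    rw [← rpow_mul_dipoleLevel hn hκ hd0 hd.2]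
    calc t ^ p * dipoleLevel n d ≤ t ^ p * decRearr n Ω u t := by
          have := le_decRearr hu.1.continuous hu.2.1 hV ht0.le htV
          gcongr
      _ ≤ WeakNorm n Ω u := hM.rpow_mul_decRearr_le_weakNorm hn hΩ hb ht0 htΩ
      _ ≤ c * L1norm n Ω (lapl n u) := hc _ _ hM
      _ ≤ max c 0 * L1norm n Ω (lapl n u) :=
          mul_le_mul_of_nonneg_right (le_max_left _ _) (integral_nonneg fun x => abs_nonneg _)
      _ ≤ max c 0 * (2 * (n * (n - 2) * κ) + E d) := by
          refine mul_le_mul_of_nonneg_left ?_ (le_max_right _ _)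
          rw [L1norm, hu.setIntegral_abs_lapl]
          exact integral_abs_lapl_truncated_dipole_le (by omega) χ hd0.ne'
  have hlhs : Tendsto (fun d : ℝ => (2 * κ) ^ p * (1 - d) ^ p *
      ((1 + d ^ 2) ^ (-β) - (d ^ 2) ^ β * (1 + d ^ 4) ^ (-β))) (𝓝[>] 0) (𝓝 ((2 * κ) ^ p)) := by
    refine tendsto_nhdsWithin_of_tendsto_nhds ?_
    have : ContinuousAt (fun d : ℝ => (2 * κ) ^ p * (1 - d) ^ p *
        ((1 + d ^ 2) ^ (-β) - (d ^ 2) ^ β * (1 + d ^ 4) ^ (-β))) 0 := by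
      refine (continuousAt_const.mul ?_).mul (ContinuousAt.sub ?_ (ContinuousAt.mul ?_ ?_))
      · exact ContinuousAt.rpow_const (by fun_prop) (Or.inr hp0.le)
      · exact ContinuousAt.rpow_const (by fun_prop) (Or.inl (by norm_num))
      · exact ContinuousAt.rpow_const (by fun_prop) (Or.inr hβ0.le)
      · exact ContinuousAt.rpow_const (by fun_prop) (Or.inl (by norm_num))
    have h := this.tendsto
    simpa [Real.zero_rpow hβ0.ne'] using h
  have hlim := le_of_tendsto_of_tendsto hlhs ((hE.const_add _).const_mul _) hev
  rw [add_zero] at hlim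
  have h1 : sharpConst n ≤ max c 0 := by
    rw [sharpConst_eq hn, div_le_iff₀ (by positivity)]
    exact hlim
  rcases le_max_iff.1 h1 with h | h
  · exact h
  · exact absurd h (not_le.2 (sharpConst_pos hn))

/-- For Ω ⊆ ℝⁿ (n ≥ 3) open and bounded (nonempty), every
u ∈ W^{2,1}_{Δ,0}(Ω) satisfies
‖u‖*_{n/(n-2),∞} ≤ 2^{-2/n} c_n (ω_{n-1}/n)^{(n-2)/n} ‖Δu‖₁, with sharp constant. -/
theorem stmt_12 (n : ℕ) (hn : 3 ≤ n) (Ω : Set (Euc n)) (hΩo : IsOpen Ω)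
    (hΩb : Bornology.IsBounded Ω) (hΩne : Ω.Nonempty) :
    (∀ u f : Euc n → ℝ, MemW21Delta0 n Ω u f →
      WeakNorm n Ω u ≤ (2 : ℝ) ^ (-(2 / (n : ℝ))) *
        cConst n * (omegaS n / (n : ℝ)) ^ (((n : ℝ) - 2) / (n : ℝ)) * L1norm n Ω f) ∧
    (∀ c : ℝ, (∀ u f : Euc n → ℝ, MemW21Delta0 n Ω u f →
        WeakNorm n Ω u ≤ c * L1norm n Ω f) →
      (2 : ℝ) ^ (-(2 / (n : ℝ))) *
        cConst n * (omegaS n / (n : ℝ)) ^ (((n : ℝ) - 2) / (n : ℝ)) ≤ c) := by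
  exact ⟨fun _ _ h => h.weakNorm_le hn hΩo hΩb, fun _ hc => sharpConst_le hn hΩo hΩb hΩne hc⟩
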